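/- A is Koszul (all its Koszul complexes are exact) if and only if the morphism g : Ω A^¡ → A is a quasi-isomorphism, i.e., g induces an isomorphism H_0(Ω A^¡) ≅ A and H_n(Ω A^¡) = 0 for every n ≥ 1. -/

import Mathlib

set_option linter.unusedSectionVars false

open TensorProduct

noncomputable section Quadratic

variable (k : Type) [Field k] [CharZero k]
variable (V : Type) [AddCommGroup V] [Module k V]

/-- Iterated tensor powers of `V`: `TP k V n = V^{⊗n}` (with `TP k V 0 = k`, `TP k V 1 = V`). -/
def TP : ℕ → ModuleCat k
  | 0 => ModuleCat.of k k
  | 1 => ModuleCat.of k V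
  | (n + 2) => ModuleCat.of k (↥(TP (n + 1)) ⊗[k] V)

/-- `V^{⊗n} ⊗ V ≅ V^{⊗(n+1)}`. -/
def stepEquiv : ∀ n : ℕ, (↥(TP k V n) ⊗[k] V) ≃ₗ[k] ↥(TP k V (n + 1))
  | 0 => TensorProduct.lid k V
  | (n + 1) => LinearEquiv.refl k ↥(TP k V (n + 2))

/-- The concatenation isomorphism `V^{⊗p} ⊗ V^{⊗q} ≅ V^{⊗(p+q)}`. -/
def concatEquiv : ∀ p q : ℕ, (↥(TP k V p) ⊗[k] ↥(TP k V q)) ≃ₗ[k] ↥(TP k V (p + q))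
  | p, 0 => TensorProduct.rid k ↥(TP k V p)
  | p, 1 => stepEquiv k V p
  | p, (q + 2) =>
      (TensorProduct.assoc k ↥(TP k V p) ↥(TP k V (q + 1)) V).symm.trans
        ((TensorProduct.congr (concatEquiv p (q + 1)) (LinearEquiv.refl k V)).trans
          (stepEquiv k V (p + (q + 1))))

/-- Transport of submodules along an equality of tensor-power indices. -/
def castTP {m n : ℕ} (h : m = n) (S : Submodule k ↥(TP k V m)) : Submodule k ↥(TP k V n) :=
  h ▸ S

/-- For `S ⊆ V^{⊗p}` and `T ⊆ V^{⊗q}`, the subspace `S ⊗ T ⊆ V^{⊗(p+q)}`. -/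
def concatSub {p q : ℕ} (S : Submodule k ↥(TP k V p)) (T : Submodule k ↥(TP k V q)) :
    Submodule k ↥(TP k V (p + q)) :=
  Submodule.map (concatEquiv k V p q).toLinearMap
    (LinearMap.range (TensorProduct.map S.subtype T.subtype))

variable (R : Submodule k ↥(TP k V 2))

/-- The subspace `V^{⊗i} ⊗ R ⊗ V^{⊗j}` of `V^{⊗(i+2+j)}`. -/
def relTerm (i j : ℕ) : Submodule k ↥(TP k V (i + 2 + j)) :=
  castTP k V (by omega)
    (concatSub k V (⊤ : Submodule k ↥(TP k V i)) (concatSub k V R (⊤ : Submodule k ↥(TP k V j))))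

/-- The weight-`d` part `Σ_{i=0}^{d−2} V^{⊗i} ⊗ R ⊗ V^{⊗(d−2−i)}` of the ideal generated by `R`,
so that the weight-`d` piece of the quadratic algebra `A = T(V)/(R)` is `A_d = V^{⊗d}/RelOf d`. -/
def RelOf (d : ℕ) : Submodule k ↥(TP k V d) :=
  ⨆ i : Fin (d - 1), castTP k V (by have := i.isLt; omega) (relTerm k V R i (d - 2 - i))

/-- The weight-`d` component of the Koszul dual of `A = T(V)/(R)`:
`A^¡_0 = k`, `A^¡_1 = V` and `A^¡_d = ⋂_{i=0}^{d−2} V^{⊗i} ⊗ R ⊗ V^{⊗(d−2−i)}` for `d ≥ 2`. -/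
def Dual (d : ℕ) : Submodule k ↥(TP k V d) :=
  ⨅ i : Fin (d - 1), castTP k V (by have := i.isLt; omega) (relTerm k V R i (d - 2 - i))

/-- The numerator `A^¡_d ⊗ V^{⊗(ρ−d)}` of the `d`-th term of the Koszul complex of weight `ρ`
(the `d`-th term of the Koszul complex is `A^¡_d ⊗ A_{ρ−d} = Kt ρ d / Kr ρ d`, with all terms
realized as subquotients of `V^{⊗ρ}` along the canonical identifications; the differentials are
then all induced by the identity of `V^{⊗ρ}`). -/
def Kt (ρ d : ℕ) : Submodule k ↥(TP k V ρ) :=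
  if h : d ≤ ρ then
    castTP k V (by omega) (concatSub k V (Dual k V R d) (⊤ : Submodule k ↥(TP k V (ρ - d))))
  else ⊥

/-- The denominator `A^¡_d ⊗ (RelOf (ρ−d))` of the `d`-th term of the Koszul complex of weight
`ρ`, so that this term is `A^¡_d ⊗ A_{ρ−d} = Kt ρ d / Kr ρ d`. -/
def Kr (ρ d : ℕ) : Submodule k ↥(TP k V ρ) :=
  if h : d ≤ ρ then
    castTP k V (by omega) (concatSub k V (Dual k V R d) (RelOf k V R (ρ - d)))
  else ⊥

/-- `A = T(V)/(R)` is Koszul: for every weight `ρ ≥ 1` the Koszul complex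
`0 → A^¡_ρ → A^¡_{ρ−1} ⊗ A_1 → ⋯ → A^¡_1 ⊗ A_{ρ−1} → A_ρ → 0`
is exact.  Realizing the `d`-th term as the subquotient `Kt ρ d / Kr ρ d` of `V^{⊗ρ}` (with the
differentials induced by the identity of `V^{⊗ρ}`), exactness at the `d`-th term reads
`Kt ρ d ⊓ Kr ρ (d−1) = Kr ρ d ⊔ Kt ρ (d+1)` (at `d = 0` the kernel of the outgoing map is
everything, whence the `if`). -/
def IsKoszul : Prop :=
  ∀ ρ ≥ 1, ∀ d ≤ ρ,
    Kt k V R ρ d ⊓ (if d = 0 then ⊤ else Kr k V R ρ (d - 1)) =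
      Kr k V R ρ d ⊔ Kt k V R ρ (d + 1)

/-! ### The cobar construction on the Koszul dual coalgebra `A^¡`

The cobar construction `Ω A^¡` is the dg algebra freely generated by the `A^¡_d` (`d ≥ 1`, in
homological degree `d − 1`), with differential the unique derivation given on generators by (a
sign times) the deconcatenations `A^¡_d → A^¡_p ⊗ A^¡_q` (`p + q = d`, `p, q ≥ 1`).  As a module
it is the sum, over all words `L = (d₁, …, d_s)` of positive integers, of
`A^¡_{d₁} ⊗ ⋯ ⊗ A^¡_{d_s}`; since `A^¡_{d₁} ⊗ ⋯ ⊗ A^¡_{d_s}` is canonically the subspace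
`dualWord L ⊆ V^{⊗(d₁+⋯+d_s)}` and the deconcatenations are the identity on representatives,
we realize `Ω A^¡` inside the ambient module `⊕_L V^{⊗(sum L)}`: the homological degree-`n`
part of `Ω A^¡` is the submodule `cobarS n` (words with `sum L − length L = n`), and the
differential is the (signed) identity maps `cobarDualD` refining one letter of a word at a time.
The dg algebra map `g : Ω A^¡ → A` sends a degree-0 word (all of whose letters are generators of
weight 1) to the product of its letters, i.e. on representatives it is the canonical projection
`V^{⊗ρ} → A_ρ`. -/

open DirectSum

/-- Words of positive integers (the letters record the weights of the generators `A^¡_d`). -/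
abbrev WordIdx : Type := {L : List ℕ // ∀ d ∈ L, 1 ≤ d}

/-- Splitting the `i`-th entry `d` of a list into two entries `p, d − p`. -/
def splitList (L : List ℕ) (i p : ℕ) : List ℕ :=
  L.take i ++ p :: (L.getD i 0 - p) :: L.drop (i + 1)

theorem splitList_pos {L : List ℕ} (hL : ∀ d ∈ L, 1 ≤ d) {i p : ℕ} (hi : i < L.length)
    (hp : 0 < p) (hpd : p < L.getD i 0) : ∀ d ∈ splitList L i p, 1 ≤ d := by
  intro d hd
  simp only [splitList, List.mem_append, List.mem_cons] at hd
  rcases hd with h | h | h | h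
  · exact hL d (List.mem_of_mem_take h)
  · omega
  · omega
  · exact hL d (List.mem_of_mem_drop h)

theorem splitList_sum {L : List ℕ} {i p : ℕ} (hi : i < L.length) (hpd : p ≤ L.getD i 0) :
    (splitList L i p).sum = L.sum := by
  conv_rhs => rw [← List.take_append_drop i L]
  rw [List.sum_append, List.drop_eq_getElem_cons hi, List.sum_cons]
  simp only [splitList, List.sum_append, List.sum_cons, List.getD_eq_getElem L 0 hi] at *
  omega

/-- Splitting a letter of a word of positive integers gives a word of positive integers. -/
def splitIdx (L : WordIdx) (i : Fin L.1.length) (p : {p : ℕ // p ∈ Finset.Ioo 0 (L.1.getD i 0)}) :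
    WordIdx :=
  ⟨splitList L.1 i p, splitList_pos L.2 i.isLt (Finset.mem_Ioo.mp p.2).1
    (Finset.mem_Ioo.mp p.2).2⟩

/-- Transport along an equality of tensor-power indices. -/
def castEquivTP {m n : ℕ} (h : m = n) : ↥(TP k V m) ≃ₗ[k] ↥(TP k V n) :=
  h ▸ LinearEquiv.refl k ↥(TP k V m)

/-- The differential of the cobar construction `Ω A^¡` on representatives: on the summand of the
word `L = (d₁, …, d_s)` it is the sum, over positions `i` and splittings `d_i = p + q` with
`p, q ≥ 1`, of `(−1)^{(d₁−1)+⋯+(d_{i−1}−1) + p + 1} ·` (the identity of `V^{⊗(sum L)}`) into the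
summand of the refined word (the deconcatenation `A^¡_{d_i} → A^¡_p ⊗ A^¡_q` is the identity on
representatives; the signs are the Koszul signs of the cobar differential). -/
def cobarDualD :
    (⨁ L : WordIdx, ↥(TP k V L.1.sum)) →ₗ[k] (⨁ L : WordIdx, ↥(TP k V L.1.sum)) :=
  DirectSum.toModule k _ _ fun L =>
    ∑ i : Fin L.1.length, ∑ p ∈ (Finset.Ioo 0 (L.1.getD i 0)).attach,
      ((-1 : k) ^ ((L.1.take i).sum + (i : ℕ) + (p : ℕ) + 1)) •
        ((DirectSum.lof k WordIdx (fun L' => ↥(TP k V L'.1.sum)) (splitIdx L i p)) ∘ₗ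
          (castEquivTP k V
            (splitList_sum i.isLt (le_of_lt (Finset.mem_Ioo.mp p.2).2)).symm).toLinearMap)

/-- For a word `L = (d₁, …, d_s)`, the subspace
`A^¡_{d₁} ⊗ ⋯ ⊗ A^¡_{d_s} ⊆ V^{⊗(d₁+⋯+d_s)}`. -/
def dualWord (R : Submodule k ↥(TP k V 2)) : (L : List ℕ) → Submodule k ↥(TP k V L.sum)
  | [] => ⊤
  | (d :: L) =>
      castTP k V (List.sum_cons (a := d) (l := L)).symm
        (concatSub k V (Dual k V R d) (dualWord R L))

/-- The homological degree-`n` part of the cobar construction `Ω A^¡`, realized inside the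
ambient module `⊕_L V^{⊗(sum L)}`: words `L` of generators `A^¡_{d_t}` with
`Σ (d_t − 1) = n`. -/
def cobarS (R : Submodule k ↥(TP k V 2)) (n : ℕ) :
    Submodule k (⨁ L : WordIdx, ↥(TP k V L.1.sum)) :=
  ⨆ (L : WordIdx) (_ : L.1.sum = L.1.length + n),
    Submodule.map (DirectSum.lof k WordIdx (fun L' => ↥(TP k V L'.1.sum)) L) (dualWord k V R L.1)

/-- The morphism `g : Ω A^¡ → A` in homological degree 0, on representatives: a degree-0 word
(all of whose letters are the weight-1 generators `A^¡_1 = V`) of total weight `ρ` is sent to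
the product of its letters, i.e. to its class in `A_ρ = V^{⊗ρ}/Rel_ρ`;  here
`A = ⊕_ρ A_ρ`. -/
def gres (R : Submodule k ↥(TP k V 2)) :
    (⨁ L : WordIdx, ↥(TP k V L.1.sum)) →ₗ[k] (⨁ ρ : ℕ, (↥(TP k V ρ) ⧸ RelOf k V R ρ)) :=
  DirectSum.toModule k _ _ fun L =>
    (DirectSum.lof k ℕ (fun ρ => ↥(TP k V ρ) ⧸ RelOf k V R ρ) L.1.sum) ∘ₗ
      (RelOf k V R L.1.sum).mkQ

/-! ### Words and the signed merging operator -/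

section Merge

variable {k}
variable {M N : Type} [AddCommGroup M] [Module k M] [AddCommGroup N] [Module k N]

/-- Increase the first letter of a word by one. -/
def bump : List ℕ → List ℕ
  | [] => []
  | d :: L => (d + 1) :: L

/-- The value at a word of the cobar differential of `c`: the signed sum of the values of `c` at
the words obtained by merging two consecutive letters. -/
def mergeD : (List ℕ → M) → List ℕ → M
  | _, [] => 0
  | _, [_] => 0
  | c, d :: e :: L =>
      (-1 : k) ^ (d + 1) • (c ((d + e) :: L) + mergeD (fun K => c (d :: K)) (e :: L))

/-- Words of positive integers of weight `ρ` and homological degree `n`. -/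
structure IsWord (ρ n : ℕ) (L : List ℕ) : Prop where
  pos : ∀ d ∈ L, 1 ≤ d
  sum_eq : L.sum = ρ
  sum_eq_length : L.sum = L.length + n

theorem length_le_sum {L : List ℕ} (h : ∀ d ∈ L, 1 ≤ d) : L.length ≤ L.sum := by
  induction L with
  | nil => simp
  | cons d L ih =>
    simp only [List.mem_cons, forall_eq_or_imp] at h
    have := ih h.2
    simp; omega

theorem IsWord.cons {ρ n d : ℕ} {L : List ℕ} (hd : 1 ≤ d) (h : IsWord ρ n L) :
    IsWord (d + ρ) (n + (d - 1)) (d :: L) := by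
  refine ⟨?_, ?_, ?_⟩
  · simpa using ⟨hd, h.pos⟩
  · simp [h.sum_eq]
  · have := h.sum_eq_length; simp; omega

theorem IsWord.one_cons {ρ n : ℕ} {L : List ℕ} (h : IsWord ρ n L) :
    IsWord (ρ + 1) n (1 :: L) := by
  simpa [add_comm] using h.cons le_rfl

theorem isWord_one_cons_iff {ρ n : ℕ} {L : List ℕ} :
    IsWord (ρ + 1) n (1 :: L) ↔ IsWord ρ n L := by
  refine ⟨fun h => ⟨fun d hd => h.pos d (by simp [hd]), ?_, ?_⟩, IsWord.one_cons⟩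
  · have := h.sum_eq; simp at this; omega
  · have := h.sum_eq_length; simp at this; omega

theorem isWord_bump {ρ n : ℕ} {L : List ℕ} (hρ : 1 ≤ ρ) (h : IsWord ρ n L) :
    IsWord (ρ + 1) (n + 1) (bump L) := by
  obtain ⟨h1, h2, h3⟩ := h
  cases L with
  | nil => simp at h2; omega
  | cons d L =>
    simp only [List.mem_cons, forall_eq_or_imp, List.sum_cons, List.length_cons] at *
    refine ⟨?_, ?_, ?_⟩
    · simpa [bump] using h1.2
    · simp [bump]; omega
    · simp [bump]; omega

/-- A nonempty positive word either starts with `1` or is bumped from a positive word. -/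
theorem IsWord.one_cons_or_bump {ρ n : ℕ} {L : List ℕ} (h : IsWord (ρ + 1) n L) :
    (∃ K, L = 1 :: K ∧ IsWord ρ n K) ∨ ∃ K m, L = bump K ∧ n = m + 1 ∧ IsWord ρ m K := by
  obtain ⟨h1, h2, h3⟩ := h
  match L, h1, h2, h3 with
  | [], _, h2, _ => simp at h2
  | 0 :: L, h1, _, _ => simp at h1
  | 1 :: L, h1, h2, h3 =>
    exact Or.inl ⟨L, rfl, isWord_one_cons_iff.1 ⟨h1, h2, h3⟩⟩
  | (d + 2) :: L, h1, h2, h3 =>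
    have hl : L.length ≤ L.sum := length_le_sum fun d hd => h1 d (by simp [hd])
    simp only [List.mem_cons, forall_eq_or_imp, List.sum_cons, List.length_cons] at *
    refine Or.inr ⟨(d + 1) :: L, n - 1, rfl, by omega, ?_, ?_, ?_⟩
    · simpa using h1.2
    · simp; omega
    · simp; omega

theorem isWord_replicate (ρ : ℕ) : IsWord ρ 0 (List.replicate ρ 1) :=
  ⟨fun d hd => by simp [List.eq_of_mem_replicate hd], by simp, by simp⟩

theorem IsWord.eq_replicate {ρ : ℕ} {L : List ℕ} (h : IsWord ρ 0 L) : L = List.replicate ρ 1 := by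
  obtain ⟨h1, h2, h3⟩ := h
  induction L generalizing ρ with
  | nil => simp at h2; subst h2; rfl
  | cons d L ih =>
    simp only [List.mem_cons, forall_eq_or_imp, List.sum_cons, List.length_cons] at *
    have := length_le_sum h1.2
    obtain rfl : d = 1 := by omega
    obtain rfl : ρ = L.sum + 1 := by omega
    rw [List.replicate_succ, ← ih h1.2 rfl (by omega)]

theorem finite_isWord (ρ n : ℕ) : {L | IsWord ρ n L}.Finite := by
  refine (Set.finite_range (fun c : Composition ρ => c.blocks)).subset ?_
  rintro L ⟨h1, h2, -⟩
  exact ⟨⟨L, fun {i} hi => h1 i hi, h2⟩, rfl⟩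

theorem mergeD_map (f : M →ₗ[k] N) (c : List ℕ → M) (L : List ℕ) :
    mergeD (k := k) (fun K => f (c K)) L = f (mergeD (k := k) c L) := by
  induction L generalizing c with
  | nil => simp [mergeD]
  | cons d L ih =>
    cases L with
    | nil => simp [mergeD]
    | cons e L => simp only [mergeD, map_smul, map_add, ← ih]

theorem mergeD_add (a b : List ℕ → M) (L : List ℕ) :
    mergeD (k := k) (a + b) L = mergeD (k := k) a L + mergeD (k := k) b L := by
  induction L generalizing a b with
  | nil => simp [mergeD]
  | cons d L ih =>
    cases L with
    | nil => simp [mergeD]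
    | cons e L =>
      have := ih (fun K => a (d :: K)) (fun K => b (d :: K))
      simp only [mergeD, Pi.add_apply, ← smul_add]
      rw [show (fun K => a (d :: K) + b (d :: K)) =
        (fun K => a (d :: K)) + (fun K => b (d :: K)) from rfl, this]
      congr 1; abel

theorem mergeD_zero (L : List ℕ) : mergeD (k := k) (0 : List ℕ → M) L = 0 :=
  mergeD_map (0 : M →ₗ[k] M) 0 L

theorem mergeD_neg (c : List ℕ → M) (L : List ℕ) :
    mergeD (k := k) (-c) L = -mergeD (k := k) c L :=
  mergeD_map (-LinearMap.id : M →ₗ[k] M) c L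

variable (k) in
/-- `mergeD` as a linear map. -/
def mergeDLin (L : List ℕ) : (List ℕ → M) →ₗ[k] M where
  toFun c := mergeD (k := k) c L
  map_add' a b := mergeD_add a b L
  map_smul' r c := mergeD_map (r • LinearMap.id : M →ₗ[k] M) c L

theorem mergeD_sum {ι : Type} (s : Finset ι) (c : ι → List ℕ → M) (L : List ℕ) :
    mergeD (k := k) (∑ i ∈ s, c i) L = ∑ i ∈ s, mergeD (k := k) (c i) L :=
  map_sum (mergeDLin k L) c s

theorem mergeD_congr {a b : List ℕ → M} {ρ n : ℕ} {L : List ℕ} (hL : IsWord ρ n L)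
    (h : ∀ K, IsWord ρ (n + 1) K → a K = b K) : mergeD (k := k) a L = mergeD (k := k) b L := by
  induction L generalizing a b ρ n with
  | nil => simp [mergeD]
  | cons d L ih =>
    cases L with
    | nil => simp [mergeD]
    | cons e L =>
      obtain ⟨h1, h2, h3⟩ := hL
      simp only [List.mem_cons, forall_eq_or_imp, List.sum_cons, List.length_cons] at h1 h2 h3
      have hl := length_le_sum h1.2.2
      simp only [mergeD]
      rw [h _ ⟨by simpa using ⟨by omega, h1.2.2⟩, by simp; omega, by simp; omega⟩]
      have hw : IsWord (e + L.sum) (e + L.sum - (L.length + 1)) (e :: L) :=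
        ⟨by simpa using h1.2, by simp, by simp; omega⟩
      rw [ih hw (a := fun K => a (d :: K)) (b := fun K => b (d :: K))]
      intro K hK
      apply h
      convert hK.cons h1.1 using 1 <;> omega

theorem mergeD_one_cons {ρ n : ℕ} (hρ : 1 ≤ ρ) (c : List ℕ → M) {K : List ℕ} (hK : IsWord ρ n K) :
    mergeD (k := k) c (1 :: K) = mergeD (k := k) (fun L => c (1 :: L)) K + c (bump K) := by
  cases K with
  | nil => have := hK.sum_eq; simp at this; omega
  | cons e L => simp [mergeD, bump, add_comm]

theorem mergeD_bump (c : List ℕ → M) (K : List ℕ) :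
    mergeD (k := k) c (bump K) = -mergeD (k := k) (fun L => c (bump L)) K := by
  match K with
  | [] => simp [mergeD, bump]
  | [d] => simp [mergeD, bump]
  | d :: e :: L =>
    simp only [mergeD, bump, pow_succ, add_right_comm d 1 e, mul_neg_one, neg_smul, neg_neg]

theorem mergeD_mergeD {ρ n : ℕ} (c : List ℕ → M) {L : List ℕ} (hL : IsWord ρ n L) :
    mergeD (k := k) (mergeD (k := k) c) L = 0 := by
  induction ρ generalizing n L c with
  | zero =>
    cases L with
    | nil => simp [mergeD]
    | cons d L =>
      have := hL.sum_eq
      have := hL.pos d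
      simp at *; omega
  | succ ρ ih =>
    rcases Nat.eq_zero_or_pos ρ with rfl | hρ
    · match L, hL with
      | [], _ => simp [mergeD]
      | [_], _ => simp [mergeD]
      | d :: e :: L, hL =>
        have := hL.sum_eq
        have := hL.pos d
        have := hL.pos e
        simp at *; omega
    · rcases hL.one_cons_or_bump with ⟨K, rfl, hK⟩ | ⟨K, m, rfl, rfl, hK⟩
      · rw [mergeD_one_cons hρ _ hK, mergeD_bump]
        rw [mergeD_congr (b := mergeD (k := k) (fun L => c (1 :: L)) + fun L => c (bump L)) hK
          (fun J hJ => mergeD_one_cons hρ _ hJ), mergeD_add, ih _ hK]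
        simp
      · rw [mergeD_bump, show (fun L => mergeD (k := k) c (bump L)) =
          -mergeD (k := k) (fun L => c (bump L)) from funext fun L => mergeD_bump c L,
          mergeD_neg, ih _ hK]
        simp

end Merge

/-! ### Exactness of complexes of words -/

section Exactness

variable {k}
variable {M : Type} [AddCommGroup M] [Module k M]

/-- Exactness in homological degree `n + 1` of the weight-`ρ` complex whose term at a word `L` is
`W L`, with differential `mergeD`. -/
def ExactAt (W : List ℕ → Submodule k M) (ρ n : ℕ) : Prop :=
  ∀ c : List ℕ → M, (∀ L, IsWord ρ (n + 1) L → c L ∈ W L) →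
    (∀ L, IsWord ρ n L → mergeD (k := k) c L = 0) →
    ∃ b : List ℕ → M, (∀ L, IsWord ρ (n + 2) L → b L ∈ W L) ∧
      ∀ L, IsWord ρ (n + 1) L → mergeD (k := k) b L = c L

/-- The function on words with value `a K` at `1 :: K` and `b K` at `bump K`. -/
def glue (a b : List ℕ → M) : List ℕ → M
  | [] => 0
  | 0 :: _ => 0
  | 1 :: K => a K
  | (d + 2) :: K => b ((d + 1) :: K)

theorem glue_bump (a b : List ℕ → M) {ρ n : ℕ} (hρ : 1 ≤ ρ) {K : List ℕ} (hK : IsWord ρ n K) :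
    glue a b (bump K) = b K := by
  match K, hK with
  | [], hK => have := hK.sum_eq; simp at this; omega
  | 0 :: K, hK => have := hK.pos 0; simp at this
  | (d + 1) :: K, _ => rfl

theorem mergeD_glue_one_cons (a b : List ℕ → M) {ρ n : ℕ} (hρ : 1 ≤ ρ) {K : List ℕ}
    (hK : IsWord ρ n K) :
    mergeD (k := k) (glue a b) (1 :: K) = mergeD (k := k) a K + b K := by
  rw [mergeD_one_cons hρ _ hK, glue_bump a b hρ hK]
  rfl

theorem mergeD_glue_bump (a b : List ℕ → M) {ρ n : ℕ} (hρ : 1 ≤ ρ) {K : List ℕ}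
    (hK : IsWord ρ n K) :
    mergeD (k := k) (glue a b) (bump K) = -mergeD (k := k) b K := by
  rw [mergeD_bump, mergeD_congr hK fun L hL => glue_bump a b hρ hL]

theorem glue_mem {W : List ℕ → Submodule k M} {a b : List ℕ → M} {ρ n : ℕ} (hρ : 1 ≤ ρ)
    (ha : ∀ K, IsWord ρ n K → a K ∈ W (1 :: K))
    (hb : ∀ K m, n = m + 1 → IsWord ρ m K → b K ∈ W (bump K)) {L : List ℕ}
    (hL : IsWord (ρ + 1) n L) : glue a b L ∈ W L := by
  rcases hL.one_cons_or_bump with ⟨K, rfl, hK⟩ | ⟨K, m, rfl, rfl, hK⟩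
  · exact ha K hK
  · rw [glue_bump a b hρ hK]
    exact hb K m rfl hK

/-- The long exact sequence attached to the subcomplex of words with first letter `1`, when this
subcomplex is exact in the relevant degree. -/
theorem exactAt_succ_iff {W : List ℕ → Submodule k M} {ρ n : ℕ} (hρ : 1 ≤ ρ)
    (hW : ∀ K m, IsWord ρ m K → W (bump K) ≤ W (1 :: K))
    (h1 : ExactAt (fun K => W (1 :: K)) ρ n) :
    ExactAt W (ρ + 1) n ↔ ∀ b : List ℕ → M, (∀ K, IsWord ρ n K → b K ∈ W (bump K)) →
      (∃ a : List ℕ → M, (∀ K, IsWord ρ (n + 1) K → a K ∈ W (1 :: K)) ∧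
        ∀ K, IsWord ρ n K → mergeD (k := k) a K = b K) →
      ∃ b' : List ℕ → M, (∀ K, IsWord ρ (n + 1) K → b' K ∈ W (bump K)) ∧
        ∀ K, IsWord ρ n K → mergeD (k := k) b' K = b K := by
  constructor
  · rintro h b hb ⟨a, ha, hab⟩
    obtain ⟨e, he, hec⟩ := h (glue a (-b)) (fun L hL => glue_mem hρ ha (fun K m hm hK => by
        obtain rfl : n = m := by omega
        exact neg_mem (hb K hK)) hL) (fun L hL => by
      rcases hL.one_cons_or_bump with ⟨K, rfl, hK⟩ | ⟨K, m, rfl, rfl, hK⟩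
      · rw [mergeD_glue_one_cons _ _ hρ hK, hab K hK]; simp
      · rw [mergeD_glue_bump _ _ hρ hK, mergeD_neg, neg_neg,
          ← mergeD_congr hK hab, mergeD_mergeD _ hK])
    refine ⟨fun K => e (bump K), fun K hK => he _ (isWord_bump hρ hK), fun K hK => ?_⟩
    have := hec _ (isWord_bump hρ hK)
    rw [mergeD_bump, glue_bump _ _ hρ hK] at this
    simpa using this
  · intro h c hc hdc
    have hab : ∀ K, IsWord ρ n K →
        mergeD (k := k) (fun L => -c (1 :: L)) K = c (bump K) := fun K hK => by
      have := hdc _ hK.one_cons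
      rw [mergeD_one_cons hρ _ hK] at this
      rw [show (fun L => -c (1 :: L)) = -(fun L => c (1 :: L)) from rfl, mergeD_neg]
      exact neg_eq_of_add_eq_zero_right this
    obtain ⟨b', hb', hb'c⟩ := h (fun K => c (bump K)) (fun K hK => hc _ (isWord_bump hρ hK))
      ⟨fun K => -c (1 :: K), fun K hK => neg_mem (hc _ hK.one_cons), hab⟩
    obtain ⟨a', ha', ha'c⟩ := h1 ((fun K => c (1 :: K)) + b')
      (fun K hK => add_mem (hc _ hK.one_cons) (hW _ _ hK (hb' K hK)))
      (fun K hK => by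
        rw [mergeD_add, hb'c K hK, ← hab K hK, ← mergeD_add]
        exact (congrArg (fun f => mergeD (k := k) f K) (by ext; simp)).trans (mergeD_zero K))
    refine ⟨glue a' (-b'), fun L hL => glue_mem hρ ha' (fun K m hm hK => ?_) hL, fun L hL => ?_⟩
    · obtain rfl : n + 1 = m := by omega
      exact neg_mem (hb' K hK)
    · rcases hL.one_cons_or_bump with ⟨K, rfl, hK⟩ | ⟨K, m, rfl, hm, hK⟩
      · rw [mergeD_glue_one_cons _ _ hρ hK, ha'c K hK]; simp
      · obtain rfl : n = m := by omega
        rw [mergeD_glue_bump _ _ hρ hK, mergeD_neg, neg_neg, hb'c K hK]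

theorem exactAt_succ_succ_iff {W : List ℕ → Submodule k M} {ρ n : ℕ} (hρ : 1 ≤ ρ)
    (hW : ∀ K m, IsWord ρ m K → W (bump K) ≤ W (1 :: K))
    (h1 : ∀ m, ExactAt (fun K => W (1 :: K)) ρ m) :
    ExactAt W (ρ + 1) (n + 1) ↔ ExactAt (fun K => W (bump K)) ρ n := by
  rw [exactAt_succ_iff hρ hW (h1 _)]
  refine forall_congr' fun b => forall_congr' fun hb => imp_congr_left ⟨?_, ?_⟩
  · rintro ⟨a, -, hab⟩ L hL
    rw [← mergeD_congr hL hab, mergeD_mergeD _ hL]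
  · exact fun h => h1 n b (fun K hK => hW _ _ hK (hb K hK)) h

/-- The space of boundaries in degree `0` and weight `m`. -/
def boundary : ℕ → (List ℕ → Submodule k M) → Submodule k M
  | 0, _ => ⊥
  | 1, _ => ⊥
  | m + 2, W => W (2 :: List.replicate m 1) ⊔ boundary (m + 1) fun K => W (1 :: K)

theorem isWord_two_cons (m : ℕ) : IsWord (m + 2) 1 (2 :: List.replicate m 1) := by
  simpa [add_comm] using (isWord_replicate m).cons (d := 2) (by omega)

theorem mem_boundary_iff {m : ℕ} {W : List ℕ → Submodule k M} {x : M} :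
    x ∈ boundary m W ↔ ∃ b : List ℕ → M, (∀ L, IsWord m 1 L → b L ∈ W L) ∧
      mergeD (k := k) b (List.replicate m 1) = x := by
  match m with
  | 0 =>
    simp only [boundary, Submodule.mem_bot, List.replicate_zero, mergeD]
    exact ⟨fun h => ⟨0, fun L hL => zero_mem _, h.symm⟩, fun ⟨_, _, h⟩ => h.symm⟩
  | 1 =>
    simp only [boundary, Submodule.mem_bot, List.replicate_one, mergeD]
    exact ⟨fun h => ⟨0, fun L hL => zero_mem _, h.symm⟩, fun ⟨_, _, h⟩ => h.symm⟩
  | m + 2 =>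
    rw [boundary, Submodule.mem_sup]
    have hm : 1 ≤ m + 1 := by omega
    have hr := isWord_replicate (m + 1)
    constructor
    · rintro ⟨y, hy, z, hz, rfl⟩
      obtain ⟨a, ha, rfl⟩ := mem_boundary_iff.1 hz
      refine ⟨glue a fun _ => y, fun L hL => glue_mem hm ha (fun K j hj hK => ?_) hL, ?_⟩
      · obtain rfl : j = 0 := by omega
        rw [hK.eq_replicate]
        exact hy
      · rw [List.replicate_succ, mergeD_glue_one_cons _ _ hm hr, add_comm]
    · rintro ⟨b, hb, rfl⟩
      refine ⟨b (2 :: List.replicate m 1), hb _ (isWord_two_cons m),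
        mergeD (k := k) (fun K => b (1 :: K)) (List.replicate (m + 1) 1),
        mem_boundary_iff.2 ⟨fun K => b (1 :: K), fun K hK => hb _ hK.one_cons, rfl⟩, ?_⟩
      rw [List.replicate_succ (n := m + 1), mergeD_one_cons hm _ hr, add_comm]
      rfl

theorem exactAt_zero_iff {W : List ℕ → Submodule k M} {ρ : ℕ} (hρ : 1 ≤ ρ)
    (hW : ∀ K m, IsWord ρ m K → W (bump K) ≤ W (1 :: K))
    (h1 : ExactAt (fun K => W (1 :: K)) ρ 0) :
    ExactAt W (ρ + 1) 0 ↔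
      W (bump (List.replicate ρ 1)) ⊓ boundary ρ (fun K => W (1 :: K)) ≤
        boundary ρ (fun K => W (bump K)) := by
  have hr := isWord_replicate ρ
  rw [exactAt_succ_iff hρ hW h1]
  constructor
  · rintro h x ⟨hx, hx'⟩
    obtain ⟨a, ha, hax⟩ := mem_boundary_iff.1 hx'
    obtain ⟨b, hb, hbx⟩ := h (fun _ => x) (fun K hK => by rwa [hK.eq_replicate])
      ⟨a, ha, fun K hK => by rwa [hK.eq_replicate]⟩
    exact mem_boundary_iff.2 ⟨b, hb, hbx _ hr⟩
  · rintro h b hb ⟨a, ha, hab⟩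
    obtain ⟨b', hb', hb'x⟩ := mem_boundary_iff.1
      (h ⟨hb _ hr, mem_boundary_iff.2 ⟨a, ha, hab _ hr⟩⟩)
    exact ⟨b', hb', fun K hK => by rw [hK.eq_replicate, hb'x]⟩

theorem exactAt_of_le (W : List ℕ → Submodule k M) {ρ n : ℕ} (h : ρ ≤ n + 1) : ExactAt W ρ n := by
  refine fun c _ _ => ⟨0, fun _ _ => zero_mem _, fun L hL => ?_⟩
  have := hL.sum_eq
  have := hL.sum_eq_length
  obtain rfl : L = [] := List.eq_nil_of_length_eq_zero (by omega)
  simp at *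

end Exactness

/-! ### Tensor powers inside the tensor algebra -/

section Embedding

/-- The canonical map from `V^{⊗n}` to the tensor algebra. -/
def tpEmb : ∀ n : ℕ, ↥(TP k V n) →ₗ[k] TensorAlgebra k V
  | 0 => Algebra.linearMap k (TensorAlgebra k V)
  | 1 => (TensorAlgebra.ι k : V →ₗ[k] TensorAlgebra k V)
  | n + 2 => LinearMap.mul' k (TensorAlgebra k V) ∘ₗ
      TensorProduct.map (tpEmb (n + 1)) (TensorAlgebra.ι k)

theorem tpEmb_stepEquiv (n : ℕ) (x : ↥(TP k V n)) (v : V) :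
    tpEmb k V (n + 1) (stepEquiv k V n (x ⊗ₜ[k] v)) = tpEmb k V n x * TensorAlgebra.ι k v := by
  cases n with
  | zero =>
    have key (r : k) (v : V) : TensorAlgebra.ι k (TensorProduct.lid k V (r ⊗ₜ[k] v)) =
        algebraMap k (TensorAlgebra k V) r * TensorAlgebra.ι k v := by
      rw [TensorProduct.lid_tmul, map_smul, Algebra.smul_def]
    exact key x v
  | succ n => rfl

theorem tpEmb_concatEquiv (p q : ℕ) (x : ↥(TP k V p)) (y : ↥(TP k V q)) :
    tpEmb k V (p + q) (concatEquiv k V p q (x ⊗ₜ[k] y)) = tpEmb k V p x * tpEmb k V q y := by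
  match q with
  | 0 =>
    have key (r : k) : tpEmb k V p (TensorProduct.rid k _ (x ⊗ₜ[k] r)) =
        tpEmb k V p x * algebraMap k (TensorAlgebra k V) r := by
      rw [TensorProduct.rid_tmul, map_smul, Algebra.smul_def, Algebra.commutes]
    exact key y
  | 1 => exact tpEmb_stepEquiv k V p x y
  | q + 2 =>
    induction y using TensorProduct.induction_on with
    | zero =>
      change tpEmb k V (p + (q + 2)) (concatEquiv k V p (q + 2) (x ⊗ₜ[k] 0)) =
        tpEmb k V p x * tpEmb k V (q + 2) 0
      rw [TensorProduct.tmul_zero, map_zero, map_zero, map_zero, mul_zero]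
    | tmul y v =>
      change tpEmb k V (p + (q + 1) + 1) (stepEquiv k V (p + (q + 1))
        (concatEquiv k V p (q + 1) (x ⊗ₜ[k] y) ⊗ₜ[k] v)) =
          tpEmb k V p x * (tpEmb k V (q + 1) y * TensorAlgebra.ι k v)
      rw [tpEmb_stepEquiv, tpEmb_concatEquiv p (q + 1) x y, mul_assoc]
    | add a b ha hb =>
      have h (z w : ↥(TP k V (q + 2))) : x ⊗ₜ[k] (z + w) = x ⊗ₜ[k] z + x ⊗ₜ[k] w :=
        TensorProduct.tmul_add _ _ _
      refine (congrArg (fun z => tpEmb k V (p + (q + 2)) (concatEquiv k V p (q + 2) z))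
        (h a b)).trans ?_
      refine (congrArg _ (map_add _ _ _)).trans ((map_add _ _ _).trans ?_)
      exact (congrArg₂ (· + ·) ha hb).trans
        ((mul_add _ _ _).symm.trans (congrArg (tpEmb k V p x * ·) (map_add _ _ _).symm))

/-- The right action of the tensor algebra on `⨁ V^{⊗n}`. -/
def rightAct : TensorAlgebra k V →ₐ[k] (Module.End k (⨁ n, ↥(TP k V n)))ᵐᵒᵖ :=
  TensorAlgebra.lift k ((MulOpposite.opLinearEquiv k).toLinearMap ∘ₗ
    LinearMap.flip (DirectSum.toModule k ℕ _ fun n =>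
      (LinearMap.compr₂ (TensorProduct.mk k ↥(TP k V n) V)
        (DirectSum.lof k ℕ (fun n => ↥(TP k V n)) (n + 1) ∘ₗ (stepEquiv k V n).toLinearMap))))

theorem rightAct_tpEmb (n : ℕ) (x : ↥(TP k V n)) :
    (rightAct k V (tpEmb k V n x)).unop (DirectSum.lof k ℕ (fun n => ↥(TP k V n)) 0 (1 : k)) =
      DirectSum.lof k ℕ (fun n => ↥(TP k V n)) n x := by
  have hι (m : ℕ) (y : ↥(TP k V m)) (v : V) : (rightAct k V (TensorAlgebra.ι k v)).unop
      (DirectSum.lof k ℕ (fun n => ↥(TP k V n)) m y) =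
      DirectSum.lof k ℕ (fun n => ↥(TP k V n)) (m + 1) (stepEquiv k V m (y ⊗ₜ[k] v)) := by
    simp [rightAct]
  match n with
  | 0 =>
    have key (r : k) : (rightAct k V (algebraMap k _ r)).unop
        (DirectSum.lof k ℕ (fun n => ↥(TP k V n)) 0 (1 : k)) =
        DirectSum.lof k ℕ (fun n => ↥(TP k V n)) 0 r := by
      rw [AlgHom.commutes]
      exact ((DirectSum.lof k ℕ (fun n => ↥(TP k V n)) 0).map_smul r (1 : k)).symm.trans
        (congrArg (DirectSum.lof k ℕ (fun n => ↥(TP k V n)) 0) (mul_one r))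
    exact key x
  | 1 =>
    have key (v : V) : TensorProduct.lid k V ((1 : k) ⊗ₜ[k] v) = v := by simp
    exact (hι 0 (1 : k) x).trans (congrArg (DirectSum.lof k ℕ (fun n => ↥(TP k V n)) 1) (key x))
  | n + 2 =>
    induction x using TensorProduct.induction_on with
    | zero =>
      change (rightAct k V (tpEmb k V (n + 2) 0)).unop _ = DirectSum.lof k ℕ _ (n + 2) 0
      simp
    | tmul x v =>
      change (rightAct k V (tpEmb k V (n + 1) x * TensorAlgebra.ι k v)).unop _ = _
      rw [map_mul, MulOpposite.unop_mul, Module.End.mul_apply, rightAct_tpEmb (n + 1) x, hι]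
      rfl
    | add a b ha hb =>
      refine Eq.trans ?_ ((congrArg₂ (· + ·) ha hb).trans (map_add _ _ _).symm)
      refine (congrArg (fun z => (rightAct k V z).unop _)
        (map_add (tpEmb k V (n + 2)) a b)).trans ?_
      rw [map_add]
      rfl

/-- The projection from the tensor algebra onto `V^{⊗n}`. -/
def tpProj (n : ℕ) : TensorAlgebra k V →ₗ[k] ↥(TP k V n) :=
  DirectSum.component k ℕ (fun n => ↥(TP k V n)) n ∘ₗ
    LinearMap.applyₗ (DirectSum.lof k ℕ (fun n => ↥(TP k V n)) 0 (1 : k)) ∘ₗ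
      (MulOpposite.opLinearEquiv k).symm.toLinearMap ∘ₗ (rightAct k V).toLinearMap

theorem tpProj_tpEmb (n : ℕ) (x : ↥(TP k V n)) : tpProj k V n (tpEmb k V n x) = x := by
  change DirectSum.component k ℕ (fun n => ↥(TP k V n)) n
    ((rightAct k V (tpEmb k V n x)).unop _) = x
  rw [rightAct_tpEmb, DirectSum.component.lof_self]

theorem tpEmb_injective (n : ℕ) : Function.Injective (tpEmb k V n) :=
  Function.LeftInverse.injective (tpProj_tpEmb k V n)

/-- The image of `V^{⊗n}` in the tensor algebra. -/
def tpRange (n : ℕ) : Submodule k (TensorAlgebra k V) := LinearMap.range (tpEmb k V n)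

theorem map_top_tpEmb (n : ℕ) : (⊤ : Submodule k ↥(TP k V n)).map (tpEmb k V n) = tpRange k V n :=
  Submodule.map_top _

theorem map_le_tpRange {n : ℕ} (S : Submodule k ↥(TP k V n)) :
    S.map (tpEmb k V n) ≤ tpRange k V n :=
  LinearMap.map_le_range

theorem map_castTP {m n : ℕ} (h : m = n) (S : Submodule k ↥(TP k V m)) :
    (castTP k V h S).map (tpEmb k V n) = S.map (tpEmb k V m) := by
  subst h; rfl

theorem map_concatSub {p q : ℕ} (S : Submodule k ↥(TP k V p)) (T : Submodule k ↥(TP k V q)) :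
    (concatSub k V S T).map (tpEmb k V (p + q)) = S.map (tpEmb k V p) * T.map (tpEmb k V q) := by
  have h : tpEmb k V (p + q) ∘ₗ (concatEquiv k V p q).toLinearMap ∘ₗ
      TensorProduct.map S.subtype T.subtype =
      LinearMap.mul' k (TensorAlgebra k V) ∘ₗ
        TensorProduct.map (tpEmb k V p ∘ₗ S.subtype) (tpEmb k V q ∘ₗ T.subtype) := by
    ext s t
    exact tpEmb_concatEquiv k V p q s t
  rw [concatSub, ← LinearMap.range_comp, ← LinearMap.range_comp, h, LinearMap.range_comp]
  rw [TensorProduct.range_map, Submodule.map_map₂]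
  simp only [LinearMap.range_comp, Submodule.range_subtype, Submodule.mul_eq_map₂]
  rfl

theorem tpRange_mul (p q : ℕ) : tpRange k V p * tpRange k V q = tpRange k V (p + q) := by
  rw [← map_top_tpEmb, ← map_top_tpEmb, ← map_top_tpEmb, ← map_concatSub]
  congr 1
  rw [concatSub, Submodule.map_eq_top_iff, LinearMap.range_eq_top]
  exact TensorProduct.map_surjective (fun x => ⟨⟨x, trivial⟩, rfl⟩) (fun x => ⟨⟨x, trivial⟩, rfl⟩)

theorem tpRange_zero : tpRange k V 0 = 1 := Submodule.one_eq_range.symm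

end Embedding

/-! ### Contractions and products of subspaces -/

section Contraction

/-- Contraction of the first `p` tensor factors of `V^{⊗(p+m)}` with a linear form. -/
def leftContr (p m : ℕ) (φ : ↥(TP k V p) →ₗ[k] k) : TensorAlgebra k V →ₗ[k] TensorAlgebra k V :=
  tpEmb k V m ∘ₗ (TensorProduct.lid k ↥(TP k V m)).toLinearMap ∘ₗ φ.rTensor ↥(TP k V m) ∘ₗ
    (concatEquiv k V p m).symm.toLinearMap ∘ₗ tpProj k V (p + m)

/-- Contraction of the last `q` tensor factors of `V^{⊗(m+q)}` with a linear form. -/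
def rightContr (m q : ℕ) (φ : ↥(TP k V q) →ₗ[k] k) : TensorAlgebra k V →ₗ[k] TensorAlgebra k V :=
  tpEmb k V m ∘ₗ (TensorProduct.rid k ↥(TP k V m)).toLinearMap ∘ₗ φ.lTensor ↥(TP k V m) ∘ₗ
    (concatEquiv k V m q).symm.toLinearMap ∘ₗ tpProj k V (m + q)

theorem leftContr_mul (p m : ℕ) (φ : ↥(TP k V p) →ₗ[k] k) (x : ↥(TP k V p)) (y : ↥(TP k V m)) :
    leftContr k V p m φ (tpEmb k V p x * tpEmb k V m y) = φ x • tpEmb k V m y := by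
  simp [leftContr, ← tpEmb_concatEquiv, tpProj_tpEmb]

theorem rightContr_mul (m q : ℕ) (φ : ↥(TP k V q) →ₗ[k] k) (x : ↥(TP k V m)) (y : ↥(TP k V q)) :
    rightContr k V m q φ (tpEmb k V m x * tpEmb k V q y) = φ y • tpEmb k V m x := by
  simp [rightContr, ← tpEmb_concatEquiv, tpProj_tpEmb]

/-- Coordinates with respect to a basis of the left tensor factor `S ⊆ V^{⊗p}`. -/
theorem exists_left_expansion {p : ℕ} (S : Submodule k ↥(TP k V p)) :
    ∃ (J : Type) (e : J → TensorAlgebra k V)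
      (κ : ℕ → J → (TensorAlgebra k V →ₗ[k] TensorAlgebra k V)),
      (∀ j, e j ∈ S.map (tpEmb k V p)) ∧
      (∀ (m : ℕ) (j : J) (U : Submodule k (TensorAlgebra k V)), U ≤ tpRange k V m →
        ∀ x ∈ tpRange k V p * U, κ m j x ∈ U) ∧
      ∀ (m : ℕ), ∀ x ∈ S.map (tpEmb k V p) * tpRange k V m,
        ∃ s : Finset J, ∀ t : Finset J, s ⊆ t → x = ∑ j ∈ t, e j * κ m j x := by
  classical
  obtain ⟨π, hπ⟩ := LinearMap.exists_leftInverse_of_injective S.subtype S.ker_subtype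
  let b := Module.Basis.ofVectorSpace k S
  refine ⟨_, fun j => tpEmb k V p (b j), fun m j => leftContr k V p m (b.coord j ∘ₗ π),
    fun j => ⟨b j, (b j).2, rfl⟩, ?_, ?_⟩
  · intro m j U hU x hx
    induction hx using Submodule.mul_induction_on' with
    | mem_mul_mem x hx u hu =>
      obtain ⟨x, rfl⟩ := hx
      obtain ⟨y, rfl⟩ := hU hu
      rw [leftContr_mul]
      exact U.smul_mem _ hu
    | add x _ y _ hx hy => rw [map_add]; exact add_mem hx hy
  · intro m x hx
    induction hx using Submodule.mul_induction_on' with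
    | mem_mul_mem x hx u hu =>
      obtain ⟨x, hx, rfl⟩ := hx
      obtain ⟨y, rfl⟩ := hu
      refine ⟨(b.repr ⟨x, hx⟩).support, fun t ht => ?_⟩
      have h1 : π x = ⟨x, hx⟩ := LinearMap.congr_fun hπ ⟨x, hx⟩
      have h2 : x = ∑ j ∈ t, b.repr ⟨x, hx⟩ j • (b j : ↥(TP k V p)) := by
        have := congrArg S.subtype (b.linearCombination_repr ⟨x, hx⟩)
        rw [Finsupp.linearCombination_apply, Finsupp.sum_of_support_subset _ ht _ (by simp),
          map_sum] at this
        simpa using this.symm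
      simp only [leftContr_mul, LinearMap.comp_apply, h1, Module.Basis.coord_apply]
      conv_lhs => rw [h2, map_sum, Finset.sum_mul]
      simp
    | add x _ y _ hx hy =>
      obtain ⟨s, hs⟩ := hx
      obtain ⟨s', hs'⟩ := hy
      refine ⟨s ∪ s', fun t ht => ?_⟩
      simp only [map_add, mul_add, Finset.sum_add_distrib]
      rw [← hs t (Finset.union_subset_left ht), ← hs' t (Finset.union_subset_right ht)]

/-- Coordinates with respect to a basis of the right tensor factor. -/
theorem exists_right_expansion (q : ℕ) :
    ∃ (J : Type) (e : J → TensorAlgebra k V)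
      (κ : ℕ → J → (TensorAlgebra k V →ₗ[k] TensorAlgebra k V)),
      (∀ j, e j ∈ tpRange k V q) ∧
      (∀ (m : ℕ) (j : J) (U : Submodule k (TensorAlgebra k V)), U ≤ tpRange k V m →
        ∀ x ∈ U * tpRange k V q, κ m j x ∈ U) ∧
      ∀ (m : ℕ), ∀ x ∈ tpRange k V m * tpRange k V q,
        ∃ s : Finset J, ∀ t : Finset J, s ⊆ t → x = ∑ j ∈ t, κ m j x * e j := by
  classical
  let b := Module.Basis.ofVectorSpace k ↥(TP k V q)
  refine ⟨_, fun j => tpEmb k V q (b j), fun m j => rightContr k V m q (b.coord j),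
    fun j => ⟨b j, rfl⟩, ?_, ?_⟩
  · intro m j U hU x hx
    induction hx using Submodule.mul_induction_on' with
    | mem_mul_mem u hu x hx =>
      obtain ⟨x, rfl⟩ := hx
      obtain ⟨y, rfl⟩ := hU hu
      rw [rightContr_mul]
      exact U.smul_mem _ hu
    | add x _ y _ hx hy => rw [map_add]; exact add_mem hx hy
  · intro m x hx
    induction hx using Submodule.mul_induction_on' with
    | mem_mul_mem u hu x hx =>
      obtain ⟨x, rfl⟩ := hx
      obtain ⟨y, rfl⟩ := hu
      refine ⟨(b.repr x).support, fun t ht => ?_⟩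
      have h2 : x = ∑ j ∈ t, b.repr x j • b j := by
        have := b.linearCombination_repr x
        rw [Finsupp.linearCombination_apply,
          Finsupp.sum_of_support_subset _ ht _ (by simp)] at this
        exact this.symm
      simp only [rightContr_mul, Module.Basis.coord_apply]
      conv_lhs => rw [h2, map_sum, Finset.mul_sum]
      simp
    | add x _ y _ hx hy =>
      obtain ⟨s, hs⟩ := hx
      obtain ⟨s', hs'⟩ := hy
      refine ⟨s ∪ s', fun t ht => ?_⟩
      simp only [map_add, add_mul, Finset.sum_add_distrib]
      rw [← hs t (Finset.union_subset_left ht), ← hs' t (Finset.union_subset_right ht)]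

theorem mul_tpRange_inf_tpRange_mul_le {p q : ℕ} (S : Submodule k ↥(TP k V p))
    {U : Submodule k (TensorAlgebra k V)} (hU : U ≤ tpRange k V q) :
    S.map (tpEmb k V p) * tpRange k V q ⊓ tpRange k V p * U ≤ S.map (tpEmb k V p) * U := by
  rintro x ⟨hx, hx'⟩
  obtain ⟨J, e, κ, he, hκ, hs⟩ := exists_left_expansion k V S
  obtain ⟨s, hs⟩ := hs q x hx
  rw [hs s subset_rfl]
  exact sum_mem fun j _ => Submodule.mul_mem_mul (he j) (hκ q j U hU x hx')

/-- Tensoring on the left with a subspace of a tensor power preserves exactness. -/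
theorem ExactAt.mul_left {W : List ℕ → Submodule k (TensorAlgebra k V)} {ρ n p : ℕ}
    (h : ExactAt W ρ n) (hW : ∀ L m, IsWord ρ m L → W L ≤ tpRange k V ρ)
    (S : Submodule k ↥(TP k V p)) :
    ExactAt (fun L => S.map (tpEmb k V p) * W L) ρ n := by
  classical
  intro c hc hdc
  obtain ⟨J, e, κ, he, hκ, hs⟩ := exists_left_expansion k V S
  have hle (L : List ℕ) (m : ℕ) (hL : IsWord ρ m L) :
      S.map (tpEmb k V p) * W L ≤ tpRange k V p * W L :=
    mul_le_mul_left (map_le_tpRange k V S) _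
  have hκc (j : J) : ∃ b : List ℕ → TensorAlgebra k V, (∀ L, IsWord ρ (n + 2) L → b L ∈ W L) ∧
      ∀ L, IsWord ρ (n + 1) L → mergeD (k := k) b L = κ ρ j (c L) := by
    refine h (fun L => κ ρ j (c L)) (fun L hL => ?_) (fun L hL => ?_)
    · exact hκ ρ j _ (hW L _ hL) _ (hle L _ hL (hc L hL))
    · rw [mergeD_map, hdc L hL, map_zero]
  choose b hb hbc using hκc
  have hs' (L : List ℕ) : ∃ s : Finset J, IsWord ρ (n + 1) L →
      ∀ t : Finset J, s ⊆ t → c L = ∑ j ∈ t, e j * κ ρ j (c L) := by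
    by_cases hL : IsWord ρ (n + 1) L
    · obtain ⟨s, hs⟩ := hs ρ (c L) (mul_le_mul_right (hW L _ hL) _ (hc L hL))
      exact ⟨s, fun _ => hs⟩
    · exact ⟨∅, fun h => absurd h hL⟩
  choose s hs' using hs'
  let t := (finite_isWord ρ (n + 1)).toFinset.biUnion s
  refine ⟨∑ j ∈ t, fun L => e j * b j L, fun L hL => ?_, fun L hL => ?_⟩
  · rw [Finset.sum_apply]
    exact sum_mem fun j _ => Submodule.mul_mem_mul (he j) (hb j L hL)
  · rw [mergeD_sum, hs' L hL t
      (Finset.subset_biUnion_of_mem s ((finite_isWord ρ (n + 1)).mem_toFinset.2 hL))]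
    refine Finset.sum_congr rfl fun j _ => ?_
    rw [← hbc j L hL]
    exact mergeD_map (LinearMap.mulLeft k (e j)) (b j) L

theorem boundary_mul (S : Submodule k (TensorAlgebra k V)) (m : ℕ)
    (W : List ℕ → Submodule k (TensorAlgebra k V)) :
    boundary m (fun L => S * W L) = S * boundary m W := by
  match m with
  | 0 => simp [boundary]
  | 1 => simp [boundary]
  | m + 2 => rw [boundary, boundary, Submodule.mul_sup, boundary_mul S (m + 1)]

end Contraction

/-! ### Subspaces of the tensor algebra attached to a quadratic algebra -/

section QuadraticData

theorem map_relTerm (i j : ℕ) : (relTerm k V R i j).map (tpEmb k V (i + 2 + j)) =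
    tpRange k V i * (R.map (tpEmb k V 2) * tpRange k V j) := by
  rw [relTerm, map_castTP, map_concatSub, map_concatSub, map_top_tpEmb, map_top_tpEmb]

/-- The component `A^¡_d`, inside the tensor algebra. -/
def dualT (d : ℕ) : Submodule k (TensorAlgebra k V) := (Dual k V R d).map (tpEmb k V d)

/-- The weight-`d` part of the ideal of relations, inside the tensor algebra. -/
def relT (d : ℕ) : Submodule k (TensorAlgebra k V) := (RelOf k V R d).map (tpEmb k V d)

/-- The product `A^¡_{d₁} ⊗ ⋯ ⊗ A^¡_{d_s}`, inside the tensor algebra. -/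
def wordT (L : List ℕ) : Submodule k (TensorAlgebra k V) := (L.map (dualT k V R)).prod

theorem dualT_le (d : ℕ) : dualT k V R d ≤ tpRange k V d := map_le_tpRange k V _

theorem relT_le (d : ℕ) : relT k V R d ≤ tpRange k V d := map_le_tpRange k V _

theorem mem_dualT_iff {d : ℕ} {x : TensorAlgebra k V} : x ∈ dualT k V R d ↔ x ∈ tpRange k V d ∧
    ∀ i j, i + 2 + j = d → x ∈ tpRange k V i * (R.map (tpEmb k V 2) * tpRange k V j) := by
  constructor
  · rintro ⟨y, hy, rfl⟩
    refine ⟨⟨y, rfl⟩, fun i j hij => ?_⟩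
    have hy' := (Submodule.mem_iInf _).1 hy ⟨i, by omega⟩
    obtain rfl : j = d - 2 - i := by omega
    rw [← map_relTerm, ← map_castTP k V hij]
    exact Submodule.mem_map_of_mem hy'
  · rintro ⟨⟨y, rfl⟩, h⟩
    refine Submodule.mem_map_of_mem ((Submodule.mem_iInf _).2 fun i => ?_)
    have hi : (i : ℕ) + 2 + (d - 2 - i) = d := by have := i.isLt; omega
    have := h i (d - 2 - i) hi
    rw [← map_relTerm, ← map_castTP k V hi] at this
    obtain ⟨z, hz, hzy⟩ := this
    rwa [tpEmb_injective k V d hzy] at hz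

theorem dualT_of_le_one {d : ℕ} (hd : d ≤ 1) : dualT k V R d = tpRange k V d := by
  ext x
  rw [mem_dualT_iff]
  exact and_iff_left fun i j hij => by omega

theorem dualT_two : dualT k V R 2 = R.map (tpEmb k V 2) := by
  ext x
  rw [mem_dualT_iff]
  constructor
  · rintro ⟨-, h⟩
    simpa [tpRange_zero] using h 0 0 rfl
  · intro h
    refine ⟨map_le_tpRange k V R h, fun i j hij => ?_⟩
    obtain rfl : i = 0 := by omega
    obtain rfl : j = 0 := by omega
    simpa [tpRange_zero] using h

theorem relT_eq_iSup (d : ℕ) : relT k V R d = ⨆ i : Fin (d - 1),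
    tpRange k V i * (R.map (tpEmb k V 2) * tpRange k V (d - 2 - i)) := by
  rw [relT, RelOf, Submodule.map_iSup]
  simp only [map_castTP, map_relTerm]

theorem relT_zero : relT k V R 0 = ⊥ := by
  rw [relT_eq_iSup]
  exact iSup_of_empty (ι := Fin 0) _

theorem relT_one : relT k V R 1 = ⊥ := by
  rw [relT_eq_iSup]
  exact iSup_of_empty (ι := Fin 0) _

theorem mul_le_relT {i j d : ℕ} (h : i + 2 + j = d) :
    tpRange k V i * (R.map (tpEmb k V 2) * tpRange k V j) ≤ relT k V R d := by
  rw [relT_eq_iSup]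
  obtain rfl : j = d - 2 - i := by omega
  exact le_iSup (fun i : Fin (d - 1) =>
    tpRange k V i * (R.map (tpEmb k V 2) * tpRange k V (d - 2 - i))) ⟨i, by omega⟩

theorem relT_succ_succ (m : ℕ) : relT k V R (m + 2) =
    dualT k V R 2 * tpRange k V m ⊔ dualT k V R 1 * relT k V R (m + 1) := by
  rw [dualT_two, dualT_of_le_one k V R le_rfl]
  apply le_antisymm
  · rw [relT_eq_iSup]
    refine iSup_le fun i => ?_
    obtain ⟨i, hi⟩ := i
    cases i with
    | zero => simp [tpRange_zero]
    | succ i =>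
      refine le_sup_of_le_right ?_
      change tpRange k V (i + 1) * (_ * tpRange k V (m + 2 - 2 - (i + 1))) ≤ _
      rw [← Nat.add_comm 1 i, ← tpRange_mul, mul_assoc]
      exact mul_le_mul_right (mul_le_relT k V R (by simp; omega)) _
  · refine sup_le ?_ ?_
    · simpa [tpRange_zero] using mul_le_relT k V R (i := 0) (j := m) (d := m + 2) (by omega)
    · rw [relT_eq_iSup, Submodule.mul_iSup]
      refine iSup_le fun i => ?_
      rw [← mul_assoc, tpRange_mul]
      have := i.isLt
      exact mul_le_relT k V R (by omega)

theorem dualT_le_mul_tpRange (p q : ℕ) : dualT k V R (p + q) ≤ dualT k V R p * tpRange k V q := by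
  intro x hx
  rw [mem_dualT_iff] at hx
  obtain ⟨J, e, κ, he, hκ, hs⟩ := exists_right_expansion k V q
  have hx1 := hx.1
  rw [← tpRange_mul] at hx1
  obtain ⟨s, hs⟩ := hs p x hx1
  rw [hs s subset_rfl]
  refine sum_mem fun j _ => Submodule.mul_mem_mul ((mem_dualT_iff k V R).2 ⟨?_, ?_⟩) (he j)
  · exact hκ p j _ le_rfl x hx1
  · intro i l hil
    refine hκ p j _ ?_ x ?_
    · rw [← hil, add_assoc, ← tpRange_mul, ← tpRange_mul]
      exact mul_le_mul_right (mul_le_mul_left (map_le_tpRange k V R) _) _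
    · rw [mul_assoc, mul_assoc, tpRange_mul]
      exact hx.2 i (l + q) (by omega)

theorem dualT_le_tpRange_mul (p q : ℕ) : dualT k V R (p + q) ≤ tpRange k V p * dualT k V R q := by
  intro x hx
  rw [mem_dualT_iff] at hx
  obtain ⟨J, e, κ, he, hκ, hs⟩ := exists_left_expansion k V (⊤ : Submodule k ↥(TP k V p))
  have hx1 := hx.1
  rw [map_top_tpEmb] at he hs
  rw [← tpRange_mul] at hx1
  obtain ⟨s, hs⟩ := hs q x hx1
  rw [hs s subset_rfl]
  refine sum_mem fun j _ => Submodule.mul_mem_mul (he j) ((mem_dualT_iff k V R).2 ⟨?_, ?_⟩)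
  · exact hκ q j _ le_rfl x hx1
  · intro i l hil
    refine hκ q j _ ?_ x ?_
    · rw [← hil, add_assoc, ← tpRange_mul, ← tpRange_mul]
      exact mul_le_mul_right (mul_le_mul_left (map_le_tpRange k V R) _) _
    · rw [← mul_assoc, tpRange_mul]
      exact hx.2 (p + i) l (by omega)

/-- The deconcatenation maps of `A^¡`. -/
theorem dualT_add_le (p q : ℕ) : dualT k V R (p + q) ≤ dualT k V R p * dualT k V R q :=
  (le_inf (dualT_le_mul_tpRange k V R p q) (dualT_le_tpRange_mul k V R p q)).trans
    (mul_tpRange_inf_tpRange_mul_le k V _ (dualT_le k V R q))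

theorem wordT_cons (d : ℕ) (L : List ℕ) : wordT k V R (d :: L) = dualT k V R d * wordT k V R L := by
  simp [wordT]

theorem wordT_le (L : List ℕ) : wordT k V R L ≤ tpRange k V L.sum := by
  induction L with
  | nil => simp [wordT, tpRange_zero]
  | cons d L ih =>
    rw [wordT_cons, List.sum_cons, ← tpRange_mul]
    exact mul_le_mul' (dualT_le k V R d) ih

theorem wordT_replicate (m : ℕ) : wordT k V R (List.replicate m 1) = tpRange k V m := by
  induction m with
  | zero => simp [wordT, tpRange_zero]
  | succ m ih =>
    rw [List.replicate_succ, wordT_cons, ih, dualT_of_le_one k V R le_rfl, tpRange_mul, add_comm]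

theorem map_dualWord (L : List ℕ) :
    (dualWord k V R L).map (tpEmb k V L.sum) = wordT k V R L := by
  induction L with
  | nil => exact (map_top_tpEmb k V 0).trans (by simp [wordT, tpRange_zero])
  | cons d L ih =>
    rw [dualWord, wordT_cons, ← ih, dualT, ← map_concatSub]
    exact map_castTP k V _ _

theorem boundary_wordT (m : ℕ) : boundary m (wordT k V R) = relT k V R m := by
  match m with
  | 0 => rw [relT_zero]; rfl
  | 1 => rw [relT_one]; rfl
  | m + 2 =>
    rw [boundary, relT_succ_succ, ← boundary_wordT (m + 1), ← boundary_mul, wordT_cons,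
      wordT_replicate]
    simp only [wordT_cons]

theorem mergeD_mem (S : Submodule k (TensorAlgebra k V)) {c : List ℕ → TensorAlgebra k V}
    {ρ n : ℕ} (hc : ∀ L, IsWord ρ (n + 1) L → c L ∈ S * wordT k V R L) {L : List ℕ}
    (hL : IsWord ρ n L) : mergeD (k := k) c L ∈ S * wordT k V R L := by
  induction L generalizing S c ρ n with
  | nil => exact zero_mem _
  | cons d L ih =>
    cases L with
    | nil => exact zero_mem _
    | cons e L =>
      obtain ⟨h1, h2, h3⟩ := hL
      simp only [List.mem_cons, forall_eq_or_imp, List.sum_cons, List.length_cons] at h1 h2 h3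
      have hl := length_le_sum h1.2.2
      refine Submodule.smul_mem _ _ (add_mem ?_ ?_)
      · have := hc ((d + e) :: L)
          ⟨by simpa using ⟨by omega, h1.2.2⟩, by simp; omega, by simp; omega⟩
        simp only [wordT_cons] at this ⊢
        rw [← mul_assoc (dualT k V R d)]
        exact mul_le_mul_right (mul_le_mul_left (dualT_add_le k V R d e) _) _ this
      · have hw : IsWord (e + L.sum) (e + L.sum - (L.length + 1)) (e :: L) :=
          ⟨by simpa using h1.2, by simp, by simp; omega⟩
        rw [wordT_cons, ← mul_assoc]
        refine ih _ (fun K hK => ?_) hw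
        rw [mul_assoc, ← wordT_cons]
        apply hc
        convert hK.cons h1.1 using 1 <;> omega

end QuadraticData

/-! ### Comparison of the Koszul complexes with the complexes of words -/

section Comparison

/-- The subspaces of the quotient complex of words with first letter at least `d + 1`. -/
def shiftT (d : ℕ) (L : List ℕ) : Submodule k (TensorAlgebra k V) := wordT k V R (bump^[d] L)

theorem bump_iterate_cons (d e : ℕ) (L : List ℕ) : bump^[d] (e :: L) = (e + d) :: L := by
  induction d generalizing e with
  | zero => rfl
  | succ d ih => rw [Function.iterate_succ_apply, bump, ih]; congr 1; omega

theorem shiftT_cons (d e : ℕ) (L : List ℕ) :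
    shiftT k V R d (e :: L) = dualT k V R (e + d) * wordT k V R L := by
  rw [shiftT, bump_iterate_cons, wordT_cons]

theorem shiftT_bump (d : ℕ) (L : List ℕ) : shiftT k V R d (bump L) = shiftT k V R (d + 1) L := rfl

theorem shiftT_bump_le {d ρ m : ℕ} (hρ : 1 ≤ ρ) (K : List ℕ) (hK : IsWord ρ m K) :
    shiftT k V R d (bump K) ≤ shiftT k V R d (1 :: K) := by
  cases K with
  | nil => have := hK.sum_eq; simp at this; omega
  | cons e L =>
    rw [shiftT_bump, shiftT_cons, shiftT_cons, wordT_cons, ← mul_assoc]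
    refine mul_le_mul_left ?_ _
    convert dualT_add_le k V R (1 + d) e using 2
    omega

theorem exactAt_shiftT_one_cons {ρ n : ℕ} (d : ℕ) (h : ExactAt (wordT k V R) ρ n) :
    ExactAt (fun K => shiftT k V R d (1 :: K)) ρ n := by
  simp only [shiftT_cons]
  exact h.mul_left k V (fun L m hL => by simpa [hL.sum_eq] using wordT_le k V R L) _

theorem boundary_shiftT (d m : ℕ) : boundary (m + 2) (shiftT k V R d) =
    dualT k V R (d + 1) * relT k V R (m + 1) ⊔ dualT k V R (d + 2) * tpRange k V m := by
  rw [boundary, shiftT_cons, wordT_replicate, sup_comm, add_comm 2 d]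
  simp only [shiftT_cons]
  rw [boundary_mul, boundary_wordT, add_comm 1 d]

/-- Exactness of the Koszul complex of weight `d + 2 + m` at its `(d + 2)`-nd term. -/
def KoszulAt (d m : ℕ) : Prop :=
  dualT k V R (d + 2) * tpRange k V m ⊓ dualT k V R (d + 1) * relT k V R (m + 1) ≤
    boundary (m + 1) (shiftT k V R (d + 1))

theorem exactAt_shiftT_iff {n d m : ℕ} (h : ∀ ρ < m + 2 + n, ∀ j, ExactAt (wordT k V R) ρ j) :
    ExactAt (shiftT k V R d) (m + 2 + n) n ↔ KoszulAt k V R (d + n) m := by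
  induction n generalizing d with
  | zero =>
    rw [add_zero, exactAt_zero_iff (by omega) (fun K j hK => shiftT_bump_le k V R (by omega) K hK)
      (exactAt_shiftT_one_cons k V R d (h _ (by omega) _))]
    simp only [shiftT_cons, boundary_mul, shiftT_bump, boundary_wordT, KoszulAt, add_zero]
    rw [List.replicate_succ, shiftT_cons, wordT_replicate, add_comm 1 d,
      show 1 + (d + 1) = d + 2 by omega]
  | succ n ih =>
    rw [← add_assoc, exactAt_succ_succ_iff (by omega)
      (fun K j hK => shiftT_bump_le k V R (by omega) K hK)
      (fun j => exactAt_shiftT_one_cons k V R d (h _ (by omega) _))]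
    simp only [shiftT_bump]
    rw [ih fun ρ hρ => h ρ (by omega), show d + 1 + n = d + (n + 1) by omega]

theorem forall_exactAt_iff :
    (∀ ρ n, ExactAt (wordT k V R) ρ n) ↔ ∀ d m, KoszulAt k V R d m := by
  constructor
  · intro h d m
    simpa using (exactAt_shiftT_iff k V R (n := d) (d := 0) (m := m) fun ρ _ j => h ρ j).1 (h _ _)
  · intro h ρ
    induction ρ using Nat.strong_induction_on with
    | _ ρ ih =>
      intro n
      rcases Nat.lt_or_ge (n + 1) ρ with hn | hn
      · obtain ⟨m, rfl⟩ : ∃ m, ρ = m + 2 + n := ⟨ρ - 2 - n, by omega⟩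
        exact (exactAt_shiftT_iff k V R (d := 0) ih).2 (h _ _)
      · exact exactAt_of_le _ hn

theorem map_Kt {ρ d m : ℕ} (h : d + m = ρ) :
    (Kt k V R ρ d).map (tpEmb k V ρ) = dualT k V R d * tpRange k V m := by
  subst h
  rw [Kt, dif_pos (Nat.le_add_right d m), map_castTP, map_concatSub, map_top_tpEmb,
    Nat.add_sub_cancel_left, dualT]

theorem map_Kr {ρ d m : ℕ} (h : d + m = ρ) :
    (Kr k V R ρ d).map (tpEmb k V ρ) = dualT k V R d * relT k V R m := by
  subst h
  rw [Kr, dif_pos (Nat.le_add_right d m), map_castTP, map_concatSub,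
    Nat.add_sub_cancel_left, dualT, relT]

theorem Kt_of_lt {ρ d : ℕ} (h : ρ < d) : Kt k V R ρ d = ⊥ := dif_neg (by omega)

theorem Kt_of_le_one {ρ d : ℕ} (hd : d ≤ 1) (h : d ≤ ρ) : Kt k V R ρ d = ⊤ := by
  obtain ⟨m, rfl⟩ := Nat.exists_eq_add_of_le h
  apply Submodule.map_injective_of_injective (tpEmb_injective k V (d + m))
  rw [map_Kt k V R rfl, map_top_tpEmb, dualT_of_le_one k V R hd, tpRange_mul]

theorem boundary_shiftT_succ (d m : ℕ) : boundary (m + 1) (shiftT k V R (d + 1)) =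
    dualT k V R (d + 2) * relT k V R m ⊔
      (Kt k V R (d + 2 + m) (d + 3)).map (tpEmb k V (d + 2 + m)) := by
  cases m with
  | zero => simp [boundary, relT_zero, Kt_of_lt]
  | succ m => rw [boundary_shiftT, map_Kt k V R (show d + 3 + m = d + 2 + (m + 1) by omega)]

theorem dualT_mul_relT_le (d m : ℕ) :
    dualT k V R (d + 2) * relT k V R m ≤ dualT k V R (d + 1) * relT k V R (m + 1) := by
  cases m with
  | zero => simp [relT_zero]
  | succ m =>
    refine (mul_le_mul_left (dualT_add_le k V R (d + 1) 1) _).trans ?_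
    rw [mul_assoc]
    refine mul_le_mul_right ?_ _
    rw [relT_succ_succ]
    exact le_sup_right

theorem dualT_mul_tpRange_le (d m : ℕ) :
    dualT k V R (d + 2) * tpRange k V m ≤ dualT k V R d * relT k V R (m + 2) := by
  refine (mul_le_mul_left (dualT_add_le k V R d 2) _).trans ?_
  rw [mul_assoc]
  refine mul_le_mul_right ?_ _
  rw [relT_succ_succ]
  exact le_sup_left

theorem boundary_shiftT_le (d m : ℕ) : boundary (m + 1) (shiftT k V R (d + 1)) ≤
    dualT k V R (d + 2) * tpRange k V m ⊓ dualT k V R (d + 1) * relT k V R (m + 1) := by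
  rw [boundary_shiftT_succ]
  refine sup_le (le_inf (mul_le_mul_right (relT_le k V R m) _) (dualT_mul_relT_le k V R d m)) ?_
  cases m with
  | zero => simp [Kt_of_lt]
  | succ m =>
    rw [map_Kt k V R (show d + 3 + m = d + 2 + (m + 1) by omega)]
    refine le_inf ?_ (dualT_mul_tpRange_le k V R (d + 1) m)
    rw [add_comm m 1, ← tpRange_mul, ← mul_assoc]
    exact mul_le_mul_left (dualT_le_mul_tpRange k V R (d + 2) 1) _

theorem koszulAt_iff (d m : ℕ) : KoszulAt k V R d m ↔
    Kt k V R (d + 2 + m) (d + 2) ⊓ Kr k V R (d + 2 + m) (d + 1) =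
      Kr k V R (d + 2 + m) (d + 2) ⊔ Kt k V R (d + 2 + m) (d + 3) := by
  have hi := tpEmb_injective k V (d + 2 + m)
  rw [← (Submodule.map_injective_of_injective hi).eq_iff, Submodule.map_inf _ hi,
    Submodule.map_sup, map_Kt k V R rfl, map_Kr k V R rfl,
    map_Kr k V R (show d + 1 + (m + 1) = d + 2 + m by omega), ← boundary_shiftT_succ, KoszulAt]
  exact ⟨fun h => le_antisymm h (boundary_shiftT_le k V R d m), fun h => h.le⟩

theorem isKoszul_iff : IsKoszul k V R ↔ ∀ d m, KoszulAt k V R d m := by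
  simp only [koszulAt_iff]
  constructor
  · intro h d m
    simpa using h (d + 2 + m) (by omega) (d + 2) (by omega)
  · intro h ρ hρ d hd
    match d, hd with
    | 0, _ => simp [Kt_of_le_one k V R, hρ]
    | 1, _ =>
      obtain ⟨m, rfl⟩ := Nat.exists_eq_add_of_le hρ
      have hi := tpEmb_injective k V (1 + m)
      apply Submodule.map_injective_of_injective hi
      rw [Kt_of_le_one k V R le_rfl hρ, if_neg one_ne_zero, top_inf_eq, Nat.sub_self,
        Submodule.map_sup, map_Kr k V R (zero_add _), map_Kr k V R rfl,
        dualT_of_le_one k V R zero_le_one, tpRange_zero, one_mul]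
      cases m with
      | zero => simp [relT_zero, relT_one, Kt_of_lt]
      | succ m =>
        rw [map_Kt k V R (show 2 + m = 1 + (m + 1) by omega), sup_comm, ← relT_succ_succ,
          show 1 + (m + 1) = m + 2 by omega]
    | d + 2, hd =>
      obtain ⟨m, rfl⟩ := Nat.exists_eq_add_of_le hd
      simpa using h d m

end Comparison

/-! ### The cobar construction inside functions on words -/

section Cobar

theorem tpEmb_castEquivTP {m n : ℕ} (h : m = n) (v : ↥(TP k V m)) :
    tpEmb k V n (castEquivTP k V h v) = tpEmb k V m v := by
  subst h
  rfl

/-- The ambient module of the cobar construction as functions on words with values in the tensor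
algebra. -/
def wordFun : (⨁ L : WordIdx, ↥(TP k V L.1.sum)) →ₗ[k] (List ℕ → TensorAlgebra k V) where
  toFun x L := if h : ∀ d ∈ L, 1 ≤ d then tpEmb k V L.sum (x ⟨L, h⟩) else 0
  map_add' x y := by
    ext L
    simp only [Pi.add_apply]
    split_ifs <;> simp
  map_smul' r x := by
    ext L
    simp only [Pi.smul_apply]
    split_ifs <;> simp [DirectSum.smul_apply]

theorem wordFun_apply (x : ⨁ L : WordIdx, ↥(TP k V L.1.sum)) (L : WordIdx) :
    wordFun k V x L.1 = tpEmb k V L.1.sum (x L) := dif_pos L.2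

theorem wordFun_of_not_pos (x : ⨁ L : WordIdx, ↥(TP k V L.1.sum)) {L : List ℕ}
    (h : ¬ ∀ d ∈ L, 1 ≤ d) : wordFun k V x L = 0 := dif_neg h

theorem wordFun_injective : Function.Injective (wordFun k V) := by
  intro x y h
  refine DFinsupp.ext fun L => tpEmb_injective k V _ ?_
  have := congrFun h L.1
  rwa [wordFun_apply, wordFun_apply] at this

theorem wordFun_lof (L : WordIdx) (v : ↥(TP k V L.1.sum)) :
    wordFun k V (DirectSum.lof k WordIdx (fun L' => ↥(TP k V L'.1.sum)) L v) =
      Pi.single L.1 (tpEmb k V L.1.sum v) := by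
  ext K
  by_cases h : ∀ d ∈ K, 1 ≤ d
  · refine (wordFun_apply k V _ ⟨K, h⟩).trans ?_
    by_cases hK : L = ⟨K, h⟩
    · subst hK
      rw [DirectSum.lof_apply, Pi.single_eq_same]
    · rw [DirectSum.lof_eq_of, DirectSum.of_eq_of_ne _ _ _ (Ne.symm hK), map_zero,
        Pi.single_eq_of_ne]
      rintro rfl
      exact hK rfl
  · rw [wordFun_of_not_pos k V _ h, Pi.single_eq_of_ne]
    rintro rfl
    exact h L.2

theorem finite_wordFun_ne_zero (x : ⨁ L : WordIdx, ↥(TP k V L.1.sum)) :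
    {L | wordFun k V x L ≠ 0}.Finite := by
  classical
  refine (x.support.finite_toSet.image Subtype.val).subset fun L hL => ?_
  by_cases h : ∀ d ∈ L, 1 ≤ d
  · refine ⟨⟨L, h⟩, ?_, rfl⟩
    simp only [Finset.mem_coe, DFinsupp.mem_support_iff]
    intro h0
    exact hL ((wordFun_apply k V x ⟨L, h⟩).trans (by rw [h0, map_zero]))
  · exact absurd (wordFun_of_not_pos k V x h) hL

theorem exists_wordFun_eq {c : List ℕ → TensorAlgebra k V} (hc : ∀ L, c L ∈ tpRange k V L.sum)
    (hpos : ∀ L, c L ≠ 0 → ∀ d ∈ L, 1 ≤ d) (hfin : {L | c L ≠ 0}.Finite) :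
    ∃ x, wordFun k V x = c := by
  change c ∈ LinearMap.range (wordFun k V)
  have h : c = ∑ L ∈ hfin.toFinset, Pi.single L (c L) := by
    ext K
    rw [Finset.sum_apply, Finset.sum_pi_single K c]
    by_cases hK : c K = 0 <;> simp [hK]
  rw [h]
  refine sum_mem fun L hL => ?_
  obtain ⟨v, hv⟩ := hc L
  rw [Set.Finite.mem_toFinset] at hL
  exact ⟨_, (wordFun_lof k V ⟨L, hpos L hL⟩ v).trans (by rw [hv])⟩

theorem splitList_succ (d : ℕ) (L : List ℕ) (i p : ℕ) :
    splitList (d :: L) (i + 1) p = d :: splitList L i p := rfl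

theorem mergeD_single {M : Type} [AddCommGroup M] [Module k M] (K : List ℕ) (t : M)
    {L : List ℕ} (hL : ∀ d ∈ L, 1 ≤ d) :
    mergeD (k := k) (Pi.single K t) L =
      ∑ i ∈ Finset.range K.length, ∑ p ∈ Finset.Ioo 0 (K.getD i 0),
        (-1 : k) ^ ((K.take i).sum + i + p + 1) •
          (Pi.single (splitList K i p) t : List ℕ → M) L := by
  induction L generalizing K with
  | nil =>
    refine (Finset.sum_eq_zero fun i _ => Finset.sum_eq_zero fun p _ => ?_).symm
    rw [Pi.single_eq_of_ne, smul_zero]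
    simp [splitList]
  | cons d L ih =>
    cases L with
    | nil =>
      refine (Finset.sum_eq_zero fun i _ => Finset.sum_eq_zero fun p _ => ?_).symm
      rw [Pi.single_eq_of_ne, smul_zero]
      intro h
      have := congrArg List.length h
      simp [splitList] at this
      omega
    | cons e L =>
      cases K with
      | nil =>
        have : (fun K => (Pi.single [] t : List ℕ → M) (d :: K)) = 0 := by
          ext K; simp
        rw [mergeD, this, mergeD_zero]
        simp
      | cons m K =>
        simp only [List.mem_cons, forall_eq_or_imp] at hL
        rw [List.length_cons, Finset.sum_range_succ', mergeD, smul_add, add_comm]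
        congr 1
        · by_cases hm : m = d
          · subst hm
            have : (fun J => (Pi.single (m :: K) t : List ℕ → M) (m :: J)) = Pi.single K t := by
              ext J; simp [Pi.single_apply]
            rw [this, ih K (by simpa using hL.2), Finset.smul_sum]
            refine Finset.sum_congr rfl fun i _ => ?_
            rw [Finset.smul_sum]
            refine Finset.sum_congr rfl fun p _ => ?_
            rw [smul_smul, ← pow_add, splitList_succ]
            simp only [Pi.single_apply, List.cons.injEq, true_and, List.take_succ_cons,
              List.sum_cons]
            congr 2
            omega
          · have : (fun J => (Pi.single (m :: K) t : List ℕ → M) (d :: J)) = 0 := by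
              ext J; simp [Ne.symm hm]
            rw [this, mergeD_zero, smul_zero]
            refine (Finset.sum_eq_zero fun i _ => Finset.sum_eq_zero fun p _ => ?_).symm
            rw [splitList_succ, Pi.single_eq_of_ne, smul_zero]
            simp [Ne.symm hm]
        · by_cases h : m = d + e ∧ K = L
          · obtain ⟨rfl, rfl⟩ := h
            rw [Finset.sum_eq_single d]
            · simp [splitList]
            · intro p _ hp
              rw [Pi.single_eq_of_ne, smul_zero]
              simp [splitList, Ne.symm hp]
            · intro h
              simp at h
              omega
          · rw [Pi.single_eq_of_ne, smul_zero]
            · refine (Finset.sum_eq_zero fun p hp => ?_).symm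
              rw [Pi.single_eq_of_ne, smul_zero]
              simp [splitList] at hp ⊢
              intro h1 h2 h3
              exact h ⟨by omega, h3.symm⟩
            · simp only [ne_eq, List.cons.injEq]
              exact fun h' => h ⟨h'.1.symm, h'.2.symm⟩

theorem wordFun_cobarDualD (x : ⨁ L : WordIdx, ↥(TP k V L.1.sum)) {L : List ℕ}
    (hL : ∀ d ∈ L, 1 ≤ d) :
    wordFun k V (cobarDualD k V x) L = mergeD (k := k) (wordFun k V x) L := by
  have : LinearMap.proj L ∘ₗ wordFun k V ∘ₗ cobarDualD k V =
      mergeDLin k L ∘ₗ wordFun k V := by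
    refine DirectSum.linearMap_ext k fun K => LinearMap.ext fun v => ?_
    simp only [LinearMap.comp_apply]
    rw [wordFun_lof]
    refine Eq.trans ?_ (mergeD_single k K.1 _ hL).symm
    rw [cobarDualD, DirectSum.toModule_lof, Finset.sum_range]
    simp only [LinearMap.sum_apply, map_sum]
    refine Finset.sum_congr rfl fun i _ => ?_
    refine (Finset.sum_congr rfl fun p _ => ?_).trans (Finset.sum_attach _ _)
    have h : K.1.sum = (splitList K.1 i p).sum :=
      (splitList_sum i.isLt (le_of_lt (Finset.mem_Ioo.mp p.2).2)).symm
    simp only [LinearMap.smul_apply, map_smul]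
    exact congrArg (_ • ·) (congrFun ((wordFun_lof k V (splitIdx K i p) (castEquivTP k V h v)).trans
      (congrArg (Pi.single (splitList K.1 i p)) (tpEmb_castEquivTP k V h v))) L)
  exact LinearMap.congr_fun this x

theorem mem_cobarS_iff {n : ℕ} {x : ⨁ L : WordIdx, ↥(TP k V L.1.sum)} : x ∈ cobarS k V R n ↔
    ∀ L, wordFun k V x L ∈ if L.sum = L.length + n then wordT k V R L else ⊥ := by
  constructor
  · intro hx
    let P : Submodule k (List ℕ → TensorAlgebra k V) :=
      Submodule.pi Set.univ fun L => if L.sum = L.length + n then wordT k V R L else ⊥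
    have : cobarS k V R n ≤ P.comap (wordFun k V) := by
      refine iSup₂_le fun K hK => Submodule.map_le_iff_le_comap.2 fun v hv => ?_
      rw [Submodule.mem_comap, Submodule.mem_comap, wordFun_lof]
      intro L _
      by_cases h : L = K.1
      · subst h
        simp only [if_pos hK, Pi.single_eq_same, ← map_dualWord]
        exact Submodule.mem_map_of_mem hv
      · rw [Pi.single_eq_of_ne h]
        exact zero_mem _
    exact fun L => this hx L trivial
  · intro h
    classical
    rw [← DirectSum.sum_support_of x]
    refine sum_mem fun L hL => ?_
    have hL' := h L.1
    rw [wordFun_apply] at hL'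
    split_ifs at hL' with hn
    · refine Submodule.mem_iSup_of_mem L (Submodule.mem_iSup_of_mem hn ⟨x L, ?_, rfl⟩)
      rw [← map_dualWord] at hL'
      obtain ⟨v, hv, hvx⟩ := hL'
      rwa [← tpEmb_injective k V _ hvx]
    · have := tpEmb_injective k V _ (((Submodule.mem_bot k).1 hL').trans (map_zero _).symm)
      rw [this, map_zero]
      exact zero_mem _

theorem wordFun_eq_zero {n : ℕ} {x : ⨁ L : WordIdx, ↥(TP k V L.1.sum)}
    (hx : x ∈ cobarS k V R n) {L : List ℕ} (hL : L.sum ≠ L.length + n) : wordFun k V x L = 0 := by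
  simpa [hL] using (mem_cobarS_iff k V R).1 hx L

theorem wordFun_mem_wordT {n : ℕ} {x : ⨁ L : WordIdx, ↥(TP k V L.1.sum)}
    (hx : x ∈ cobarS k V R n) (L : List ℕ) : wordFun k V x L ∈ wordT k V R L := by
  have := (mem_cobarS_iff k V R).1 hx L
  split_ifs at this
  · exact this
  · rw [(Submodule.mem_bot k).1 this]
    exact zero_mem _

theorem isWord_of_pos {L : List ℕ} (h : ∀ d ∈ L, 1 ≤ d) : IsWord L.sum (L.sum - L.length) L :=
  ⟨h, rfl, by have := length_le_sum h; omega⟩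

theorem cobarDualD_mem {n : ℕ} {x : ⨁ L : WordIdx, ↥(TP k V L.1.sum)}
    (hx : x ∈ cobarS k V R (n + 1)) : cobarDualD k V x ∈ cobarS k V R n := by
  rw [mem_cobarS_iff]
  intro L
  by_cases h : ∀ d ∈ L, 1 ≤ d
  · rw [wordFun_cobarDualD k V x h]
    split_ifs with hn
    · rw [← one_mul (wordT k V R L)]
      refine mergeD_mem k V R 1 (ρ := L.sum) (n := n) (fun K _ => ?_) ⟨h, rfl, hn⟩
      rw [one_mul]
      exact wordFun_mem_wordT k V R hx K
    · rw [mergeD_congr (isWord_of_pos h) (b := 0), mergeD_zero]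
      · exact zero_mem _
      · intro K hK
        refine wordFun_eq_zero k V R hx ?_
        have := hK.sum_eq
        have := hK.sum_eq_length
        have := length_le_sum h
        omega
  · rw [wordFun_of_not_pos k V _ h]
    exact zero_mem _

theorem cobarDualD_eq_zero_iff {n : ℕ} {x : ⨁ L : WordIdx, ↥(TP k V L.1.sum)}
    (hx : x ∈ cobarS k V R (n + 1)) : cobarDualD k V x = 0 ↔
      ∀ ρ L, IsWord ρ n L → mergeD (k := k) (wordFun k V x) L = 0 := by
  constructor
  · intro h ρ L hL
    rw [← wordFun_cobarDualD k V x hL.pos, h, map_zero, Pi.zero_apply]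
  · intro h
    refine wordFun_injective k V (funext fun L => ?_)
    rw [map_zero, Pi.zero_apply]
    by_cases hp : ∀ d ∈ L, 1 ≤ d
    · by_cases hn : L.sum = L.length + n
      · rw [wordFun_cobarDualD k V x hp, h L.sum L ⟨hp, rfl, hn⟩]
      · exact wordFun_eq_zero k V R (cobarDualD_mem k V R hx) hn
    · exact wordFun_of_not_pos k V _ hp

theorem mem_map_cobarDualD_iff {n : ℕ} {y : ⨁ L : WordIdx, ↥(TP k V L.1.sum)} :
    y ∈ (cobarS k V R (n + 1)).map (cobarDualD k V) ↔ y ∈ cobarS k V R n ∧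
      ∀ ρ, ∃ b : List ℕ → TensorAlgebra k V, (∀ L, IsWord ρ (n + 1) L → b L ∈ wordT k V R L) ∧
        ∀ L, IsWord ρ n L → mergeD (k := k) b L = wordFun k V y L := by
  constructor
  · rintro ⟨x, hx, rfl⟩
    exact ⟨cobarDualD_mem k V R hx, fun ρ => ⟨wordFun k V x,
      fun L _ => wordFun_mem_wordT k V R hx L, fun L hL => (wordFun_cobarDualD k V x hL.pos).symm⟩⟩
  · rintro ⟨hy, h⟩
    choose b hb hby using h
    classical
    let W : Set ℕ := List.sum '' {L | wordFun k V y L ≠ 0}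
    have hW : W.Finite := (finite_wordFun_ne_zero k V y).image _
    let c : List ℕ → TensorAlgebra k V := fun L =>
      if L.sum ∈ W ∧ IsWord L.sum (n + 1) L then b L.sum L else 0
    have hc : ∀ L, c L ∈ if L.sum = L.length + (n + 1) then wordT k V R L else ⊥ := by
      intro L
      by_cases hL : L.sum ∈ W ∧ IsWord L.sum (n + 1) L
      · simp only [c]
        rw [if_pos hL, if_pos hL.2.sum_eq_length]
        exact hb _ _ hL.2
      · simp only [c]
        rw [if_neg hL]
        exact zero_mem _
    obtain ⟨x, hx⟩ : ∃ x, wordFun k V x = c := by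
      refine exists_wordFun_eq k V (fun L => ?_) (fun L hL => ?_) ?_
      · have := hc L
        split_ifs at this
        · exact wordT_le k V R L this
        · rw [(Submodule.mem_bot k).1 this]
          exact zero_mem _
      · by_contra h
        exact hL (if_neg fun h' => h h'.2.pos)
      · refine (hW.biUnion fun ρ _ => finite_isWord ρ (n + 1)).subset fun L hL => ?_
        by_contra h
        simp only [Set.mem_iUnion, not_exists] at h
        exact hL (if_neg fun h' => h _ h'.1 h'.2)
    have hxS : x ∈ cobarS k V R (n + 1) := by
      rw [mem_cobarS_iff, hx]
      exact hc
    refine ⟨x, hxS, wordFun_injective k V (funext fun L => ?_)⟩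
    by_cases hp : ∀ d ∈ L, 1 ≤ d
    · by_cases hn : L.sum = L.length + n
      · have hL : IsWord L.sum n L := ⟨hp, rfl, hn⟩
        rw [wordFun_cobarDualD k V x hp, hx]
        by_cases hLW : L.sum ∈ W
        · rw [← hby _ L hL]
          refine mergeD_congr hL fun K hK => if_pos ?_ |>.trans ?_
          · rw [hK.sum_eq]
            exact ⟨hLW, hK⟩
          · rw [hK.sum_eq]
        · rw [mergeD_congr (b := 0) hL, mergeD_zero]
          · by_contra h
            exact hLW ⟨L, Ne.symm h, rfl⟩
          · intro K hK
            refine if_neg ?_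
            rw [hK.sum_eq]
            exact fun h => hLW h.1
      · rw [wordFun_eq_zero k V R hy hn, wordFun_eq_zero k V R (cobarDualD_mem k V R hxS) hn]
    · rw [wordFun_of_not_pos k V _ hp, wordFun_of_not_pos k V _ hp]

theorem exact_cobar_succ_iff (n : ℕ) :
    cobarS k V R (n + 1) ⊓ LinearMap.ker (cobarDualD k V) =
      Submodule.map (cobarDualD k V) (cobarS k V R (n + 2)) ↔
    ∀ ρ, ExactAt (wordT k V R) ρ n := by
  constructor
  · intro h ρ c hc hc0
    classical
    let c' : List ℕ → TensorAlgebra k V := fun L => if IsWord ρ (n + 1) L then c L else 0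
    have hc' : ∀ L, c' L ∈ if L.sum = L.length + (n + 1) then wordT k V R L else ⊥ := by
      intro L
      by_cases hL : IsWord ρ (n + 1) L
      · simp only [c']
        rw [if_pos hL, if_pos hL.sum_eq_length]
        exact hc _ hL
      · simp only [c']
        rw [if_neg hL]
        exact zero_mem _
    obtain ⟨x, hx⟩ : ∃ x, wordFun k V x = c' := by
      refine exists_wordFun_eq k V (fun L => ?_) (fun L hL => ?_) ?_
      · have := hc' L
        split_ifs at this
        · exact wordT_le k V R L this
        · rw [(Submodule.mem_bot k).1 this]
          exact zero_mem _
      · by_contra h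
        exact hL (if_neg fun h' => h h'.pos)
      · refine (finite_isWord ρ (n + 1)).subset fun L hL => ?_
        by_contra h
        exact hL (if_neg h)
    have hxS : x ∈ cobarS k V R (n + 1) := by
      rw [mem_cobarS_iff, hx]
      exact hc'
    have hx0 : cobarDualD k V x = 0 := by
      rw [cobarDualD_eq_zero_iff k V R hxS, hx]
      intro σ L hL
      by_cases hσ : σ = ρ
      · subst hσ
        rw [mergeD_congr hL fun K hK => if_pos hK, hc0 L hL]
      · rw [mergeD_congr (b := 0) hL, mergeD_zero]
        exact fun K hK => if_neg fun h' => hσ (hK.sum_eq.symm.trans h'.sum_eq)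
    have hxm := h.le ⟨hxS, hx0⟩
    obtain ⟨b, hb, hbx⟩ := ((mem_map_cobarDualD_iff k V R).1 hxm).2 ρ
    refine ⟨b, hb, fun L hL => (hbx L hL).trans ?_⟩
    rw [hx]
    exact if_pos hL
  · intro h
    ext x
    rw [mem_map_cobarDualD_iff, Submodule.mem_inf, LinearMap.mem_ker]
    refine and_congr_right fun hx => ?_
    rw [cobarDualD_eq_zero_iff k V R hx]
    refine forall_congr' fun ρ => ⟨?_, ?_⟩
    · exact h ρ _ fun L _ => wordFun_mem_wordT k V R hx L
    · rintro ⟨b, -, hb⟩ L hL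
      rw [← mergeD_congr hL hb, mergeD_mergeD b hL]

theorem gres_apply {x : ⨁ L : WordIdx, ↥(TP k V L.1.sum)} (hx : x ∈ cobarS k V R 0) (ρ : ℕ) :
    gres k V R x ρ =
      (RelOf k V R ρ).mkQ (tpProj k V ρ (wordFun k V x (List.replicate ρ 1))) := by
  let F : (⨁ L : WordIdx, ↥(TP k V L.1.sum)) →ₗ[k] (↥(TP k V ρ) ⧸ RelOf k V R ρ) :=
    DirectSum.component k ℕ (fun ρ => ↥(TP k V ρ) ⧸ RelOf k V R ρ) ρ ∘ₗ gres k V R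
  let G : (⨁ L : WordIdx, ↥(TP k V L.1.sum)) →ₗ[k] (↥(TP k V ρ) ⧸ RelOf k V R ρ) :=
    (RelOf k V R ρ).mkQ ∘ₗ tpProj k V ρ ∘ₗ LinearMap.proj (List.replicate ρ 1) ∘ₗ wordFun k V
  suffices cobarS k V R 0 ≤ LinearMap.eqLocus F G from this hx
  refine iSup₂_le fun K hK => Submodule.map_le_iff_le_comap.2 fun v hv => ?_
  have hKr := IsWord.eq_replicate ⟨K.2, rfl, hK⟩
  change F _ = G _
  simp only [F, G, LinearMap.comp_apply, gres, DirectSum.toModule_lof, LinearMap.proj_apply,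
    wordFun_lof]
  by_cases h : K.1.sum = ρ
  · subst h
    rw [← hKr, Pi.single_eq_same, tpProj_tpEmb, DirectSum.component.lof_self]
  · rw [Pi.single_eq_of_ne, map_zero, map_zero, DirectSum.component.of, dif_neg h]
    intro h'
    rw [← h'] at h
    simp at h

theorem gres_eq_zero_iff {x : ⨁ L : WordIdx, ↥(TP k V L.1.sum)} (hx : x ∈ cobarS k V R 0) :
    gres k V R x = 0 ↔ ∀ ρ, wordFun k V x (List.replicate ρ 1) ∈ relT k V R ρ := by
  rw [DFinsupp.ext_iff]
  refine forall_congr' fun ρ => ?_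
  have hρ := wordFun_mem_wordT k V R hx (List.replicate ρ 1)
  rw [wordT_replicate] at hρ
  obtain ⟨v, hv⟩ := hρ
  erw [gres_apply k V R hx]
  rw [← hv, tpProj_tpEmb, DFinsupp.zero_apply, Submodule.mkQ_apply,
    Submodule.Quotient.mk_eq_zero, relT]
  exact ((tpEmb_injective k V ρ).mem_set_image).symm

theorem map_gres_cobarS_zero : Submodule.map (gres k V R) (cobarS k V R 0) = ⊤ := by
  rw [eq_top_iff]
  rintro z -
  induction z using DirectSum.induction_on with
  | zero => exact zero_mem _
  | add y z hy hz => exact add_mem hy hz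
  | of ρ q =>
    obtain ⟨v, rfl⟩ := Submodule.mkQ_surjective _ q
    obtain ⟨x, hx⟩ : ∃ x, wordFun k V x = Pi.single (List.replicate ρ 1) (tpEmb k V ρ v) := by
      refine exists_wordFun_eq k V (fun L => ?_) (fun L hL => ?_) ?_
      · by_cases h : L = List.replicate ρ 1
        · subst h
          rw [Pi.single_eq_same]
          simpa using map_le_tpRange k V ⊤ (Submodule.mem_map_of_mem (Submodule.mem_top (x := v)))
        · rw [Pi.single_eq_of_ne h]
          exact zero_mem _
      · by_cases h : L = List.replicate ρ 1
        · subst h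
          exact (isWord_replicate ρ).pos
        · exact absurd (Pi.single_eq_of_ne h _) hL
      · exact (Set.finite_singleton (List.replicate ρ 1)).subset fun L hL => by
          by_contra h
          exact hL (Pi.single_eq_of_ne h _)
    have hxS : x ∈ cobarS k V R 0 := by
      rw [mem_cobarS_iff, hx]
      intro L
      by_cases h : L = List.replicate ρ 1
      · subst h
        rw [Pi.single_eq_same, if_pos (isWord_replicate ρ).sum_eq_length, wordT_replicate]
        exact map_le_tpRange k V ⊤ (Submodule.mem_map_of_mem (Submodule.mem_top (x := v)))
      · rw [Pi.single_eq_of_ne h]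
        exact zero_mem _
    refine ⟨x, hxS, DFinsupp.ext fun σ => ?_⟩
    erw [gres_apply k V R hxS σ]
    rw [hx]
    by_cases h : σ = ρ
    · subst h
      rw [Pi.single_eq_same, tpProj_tpEmb]
      exact (DirectSum.of_eq_same (β := fun ρ => ↥(TP k V ρ) ⧸ RelOf k V R ρ) _ _).symm
    · rw [Pi.single_eq_of_ne, map_zero, map_zero]
      · exact (DirectSum.of_eq_of_ne (β := fun ρ => ↥(TP k V ρ) ⧸ RelOf k V R ρ) _ _ _ h).symm
      · intro h'
        exact h (by simpa using congrArg List.length h')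

theorem cobarS_zero_inf_ker_gres : cobarS k V R 0 ⊓ LinearMap.ker (gres k V R) =
    Submodule.map (cobarDualD k V) (cobarS k V R 1) := by
  ext x
  rw [mem_map_cobarDualD_iff, Submodule.mem_inf, LinearMap.mem_ker]
  refine and_congr_right fun hx => ?_
  rw [gres_eq_zero_iff k V R hx]
  refine forall_congr' fun ρ => ?_
  rw [← boundary_wordT, mem_boundary_iff]
  refine exists_congr fun b => and_congr_right fun _ =>
    ⟨fun h L hL => by rwa [hL.eq_replicate], fun h => h _ (isWord_replicate ρ)⟩

end Cobar

/-- **Koszulness via the cobar resolution.**  `A = T(V)/(R)` is Koszul (all its Koszul complexes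
are exact) if and only if the morphism `g : Ω A^¡ → A` is a quasi-isomorphism: `g` induces an
isomorphism `H₀(Ω A^¡) ≅ A` (i.e. `g` restricted to degree-0 cycles is onto `A` and its kernel
consists exactly of the boundaries), and `Hₙ(Ω A^¡) = 0` for every `n ≥ 1`. -/
theorem statement15 (R : Submodule k ↥(TP k V 2)) :
    IsKoszul k V R ↔
      (Submodule.map (gres k V R) (cobarS k V R 0) = ⊤ ∧
       cobarS k V R 0 ⊓ LinearMap.ker (gres k V R) =
         Submodule.map (cobarDualD k V) (cobarS k V R 1) ∧
       ∀ n : ℕ,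
         cobarS k V R (n + 1) ⊓ LinearMap.ker (cobarDualD k V) =
           Submodule.map (cobarDualD k V) (cobarS k V R (n + 2))) := by
  rw [isKoszul_iff, ← forall_exactAt_iff, forall_comm]
  simp only [exact_cobar_succ_iff, map_gres_cobarS_zero, cobarS_zero_inf_ker_gres, true_and]

end Quadratic
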